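/- Let R be a nonempty graphon property. Then R is testable if and only if the graphon functional W ↦ d₁(W,R) is a testable functional. -/

import Mathlib

open MeasureTheory Filter Topology
open scoped ENNReal

noncomputable section

/-- The unit interval `[0,1]` as a subset of `ℝ`. -/
def I01 : Set ℝ := Set.Icc 0 1

/-- `W₀`: symmetric measurable functions `[0,1]² → [0,1]`
(represented as functions `ℝ → ℝ → ℝ`, with the relevant values on `[0,1]²`). -/
def IsGraphon (W : ℝ → ℝ → ℝ) : Prop :=
  Measurable (Function.uncurry W) ∧ (∀ x y, W x y = W y x) ∧
    ∀ x y, W x y ∈ Set.Icc (0 : ℝ) 1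

/-- The `L¹` norm of a kernel on `[0,1]²`. -/
def l1Norm (W : ℝ → ℝ → ℝ) : ℝ :=
  ∫ x in I01, ∫ y in I01, |W x y|

/-- The cut norm of a kernel on `[0,1]²`. -/
def cutNorm (W : ℝ → ℝ → ℝ) : ℝ :=
  sSup { r : ℝ | ∃ S T : Set ℝ, MeasurableSet S ∧ MeasurableSet T ∧ S ⊆ I01 ∧ T ⊆ I01 ∧
    r = |∫ x in S, ∫ y in T, W x y| }

/-- An invertible measure preserving map of `[0,1]`. -/
structure InvMP where
  toFun : ℝ → ℝ
  invFun : ℝ → ℝ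
  maps : ∀ x ∈ I01, toFun x ∈ I01
  mapsInv : ∀ x ∈ I01, invFun x ∈ I01
  measurePreserving :
    MeasurePreserving toFun (volume.restrict I01) (volume.restrict I01)
  measurePreservingInv :
    MeasurePreserving invFun (volume.restrict I01) (volume.restrict I01)
  leftInv : ∀ x ∈ I01, invFun (toFun x) = x
  rightInv : ∀ x ∈ I01, toFun (invFun x) = x

/-- `δ_□`: the cut distance, infimum of the cut norm over invertible measure
preserving transformations of `[0,1]`. -/
def deltaCut (U W : ℝ → ℝ → ℝ) : ℝ :=
  ⨅ φ : InvMP, cutNorm (fun x y => U x y - W (φ.toFun x) (φ.toFun y))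

/-- `δ₁`: the `L¹` distance minimized over invertible measure preserving
transformations of `[0,1]`. -/
def delta1 (U W : ℝ → ℝ → ℝ) : ℝ :=
  ⨅ φ : InvMP, l1Norm (fun x y => U x y - W (φ.toFun x) (φ.toFun y))



/-- A graph property: for each `n`, a set of simple graphs on `Fin n`. -/
def GraphProp := ∀ n : ℕ, Set (SimpleGraph (Fin n))

/-- Invariance under isomorphism (isomorphic graphs necessarily have the same
number of vertices). -/
def IsGraphProperty (P : GraphProp) : Prop :=
  ∀ (n : ℕ) (G H : SimpleGraph (Fin n)), Nonempty (G ≃g H) → (G ∈ P n ↔ H ∈ P n)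

/-- The normalized edit distance between graphs on a common vertex set. -/
def graphD1 {n : ℕ} (G H : SimpleGraph (Fin n)) : ℝ :=
  (symmDiff G.edgeSet H.edgeSet).ncard / (n ^ 2 : ℝ)

/-- The edit distance from a graph to a graph property (∞ if the property
contains no graph on the same number of nodes). -/
def graphD1P {n : ℕ} (G : SimpleGraph (Fin n)) (P : GraphProp) : ℝ≥0∞ :=
  ⨅ (H : SimpleGraph (Fin n)) (_ : H ∈ P n), ENNReal.ofReal (graphD1 G H)

open Classical in
/-- The step function `W_G` associated with a graph `G` on `{1,…,n}`:
its value on `((i−1)/n, i/n] × ((j−1)/n, j/n]` is `1` iff `ij ∈ E(G)`. -/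
def graphonOf {n : ℕ} (G : SimpleGraph (Fin n)) : ℝ → ℝ → ℝ := fun x y =>
  if ∃ i j : Fin n, G.Adj i j ∧ x ∈ Set.Ioc (((i : ℕ) : ℝ) / n) ((((i : ℕ) : ℝ) + 1) / n)
      ∧ y ∈ Set.Ioc (((j : ℕ) : ℝ) / n) ((((j : ℕ) : ℝ) + 1) / n)
  then 1 else 0

/-- `H` is (isomorphic to) an induced subgraph of `G`. -/
def IsInducedSubgraph {n k : ℕ} (G : SimpleGraph (Fin n)) (H : SimpleGraph (Fin k)) : Prop :=
  ∃ f : Fin k ↪ Fin n, ∀ i j, H.Adj i j ↔ G.Adj (f i) (f j)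

/-- The subgraph of `G` induced on the vertex subset `S` has property `P`
(as a graph on `k = |S|` nodes). -/
def inducedMem {n : ℕ} (G : SimpleGraph (Fin n)) (S : Finset (Fin n)) (k : ℕ)
    (P : GraphProp) : Prop :=
  ∃ H : SimpleGraph (Fin k), H ∈ P k ∧
    ∃ f : Fin k ↪ Fin n, (∀ i, f i ∈ S) ∧ ∀ i j, H.Adj i j ↔ G.Adj (f i) (f j)

/-- The number of `k`-element vertex subsets of `G` inducing a subgraph with property `P`. -/
def goodCount {n : ℕ} (G : SimpleGraph (Fin n)) (k : ℕ) (P : GraphProp) : ℕ :=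
  {S : Finset (Fin n) | S.card = k ∧ inducedMem G S k P}.ncard

/-- Testability of a graph property (Definition 1.1 of the paper). -/
def GraphTestable (P : GraphProp) : Prop :=
  ∃ P' : GraphProp, IsGraphProperty P' ∧
    (∀ (n : ℕ) (G : SimpleGraph (Fin n)), G ∈ P n → ∀ k, 1 ≤ k → k ≤ n →
      2 * n.choose k ≤ 3 * goodCount G k P') ∧
    (∀ ε : ℝ, 0 < ε → ∃ kε : ℕ, 1 ≤ kε ∧
      ∀ (n : ℕ) (G : SimpleGraph (Fin n)) (k : ℕ), kε ≤ k → k ≤ n →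
        ENNReal.ofReal ε ≤ graphD1P G P →
        3 * goodCount G k P' ≤ n.choose k)

def cube (k : ℕ) : Set (Fin k → ℝ) := Set.univ.pi fun _ => I01

open Classical in
/-- The homomorphism density `t(F,W)`. -/
def homDensity {k : ℕ} (F : SimpleGraph (Fin k)) (W : ℝ → ℝ → ℝ) : ℝ :=
  ∫ x in cube k, ∏ i : Fin k, ∏ j : Fin k,
    if i < j ∧ F.Adj i j then W (x i) (x j) else 1

open Classical in
/-- The induced density `t_ind(F,W)`. -/
def indDensity {k : ℕ} (F : SimpleGraph (Fin k)) (W : ℝ → ℝ → ℝ) : ℝ :=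
  ∫ x in cube k, ∏ i : Fin k, ∏ j : Fin k,
    if i < j then (if F.Adj i j then W (x i) (x j) else 1 - W (x i) (x j)) else 1

/-- Isomorphism of functions in `W₀`: equality of all homomorphism densities. -/
def GraphonIso (U W : ℝ → ℝ → ℝ) : Prop :=
  ∀ (k : ℕ) (F : SimpleGraph (Fin k)), homDensity F U = homDensity F W

open Classical in
/-- `P(G(k,W) ∈ R')`, the probability that the `W`-random graph on `k` nodes
has property `R'`. -/
def probIn (k : ℕ) (W : ℝ → ℝ → ℝ) (R' : GraphProp) : ℝ :=
  ∑ F : SimpleGraph (Fin k), if F ∈ R' k then indDensity F W else 0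

/-- The `L¹` distance from `W` to a set `R` of kernels, with value `∞` for `R = ∅`. -/
def d1SetE (W : ℝ → ℝ → ℝ) (R : Set (ℝ → ℝ → ℝ)) : ℝ≥0∞ :=
  ⨅ (U : ℝ → ℝ → ℝ) (_ : U ∈ R), ENNReal.ofReal (l1Norm fun x y => W x y - U x y)

/-- The cut-norm distance from `W` to a set `R` of kernels, with value `∞` for `R = ∅`. -/
def dCutSetE (W : ℝ → ℝ → ℝ) (R : Set (ℝ → ℝ → ℝ)) : ℝ≥0∞ :=
  ⨅ (U : ℝ → ℝ → ℝ) (_ : U ∈ R), ENNReal.ofReal (cutNorm fun x y => W x y - U x y)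

/-- The open ball `B₁(R,c)` (within `W₀`). -/
def ball1 (R : Set (ℝ → ℝ → ℝ)) (c : ℝ) : Set (ℝ → ℝ → ℝ) :=
  {W | IsGraphon W ∧ d1SetE W R < ENNReal.ofReal c}

/-- The open ball `B_□(R,c)` (within `W₀`). -/
def ballCut (R : Set (ℝ → ℝ → ℝ)) (c : ℝ) : Set (ℝ → ℝ → ℝ) :=
  {W | IsGraphon W ∧ dCutSetE W R < ENNReal.ofReal c}

/-- A graphon property: a set of graphons invariant under isomorphism. -/
def IsGraphonProperty (R : Set (ℝ → ℝ → ℝ)) : Prop :=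
  (∀ W ∈ R, IsGraphon W) ∧
    ∀ U W, IsGraphon U → IsGraphon W → GraphonIso U W → (U ∈ R ↔ W ∈ R)

/-- A set of graphons is closed if it is closed in the cut norm. -/
def CutClosed (R : Set (ℝ → ℝ → ℝ)) : Prop :=
  ∀ W, IsGraphon W →
    (∀ ε : ℝ, 0 < ε → ∃ U ∈ R, cutNorm (fun x y => W x y - U x y) < ε) → W ∈ R

/-- Testability of a graphon property. -/
def GraphonTestable (R : Set (ℝ → ℝ → ℝ)) : Prop :=
  ∃ R' : GraphProp, IsGraphProperty R' ∧
    (∀ W ∈ R, ∀ k : ℕ, 1 ≤ k → (2 : ℝ) / 3 ≤ probIn k W R') ∧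
    (∀ ε : ℝ, 0 < ε → ∃ kε : ℕ, 1 ≤ kε ∧ ∀ k, kε ≤ k → ∀ W, IsGraphon W →
      ENNReal.ofReal ε ≤ d1SetE W R → probIn k W R' ≤ 1 / 3)

/-- The closure `P̄` of a graph property: limits of convergent sequences
of graphs in `P` with sizes tending to infinity. -/
def closureP (P : GraphProp) : Set (ℝ → ℝ → ℝ) :=
  {W | IsGraphon W ∧ ∃ (n : ℕ → ℕ) (G : ∀ m, SimpleGraph (Fin (n m))),
    (∀ m, G m ∈ P (n m)) ∧ Tendsto n atTop atTop ∧
    Tendsto (fun m => deltaCut (graphonOf (G m)) W) atTop (nhds 0)}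

/-- A graph property is robust if graphs whose `W_G` is `d₁`-close to `P̄`
are themselves close to `P` in edit distance. -/
def Robust (P : GraphProp) : Prop :=
  ∀ ε : ℝ, 0 < ε → ∃ (N : ℕ) (ε' : ℝ), 1 ≤ N ∧ 0 < ε' ∧
    ∀ (n : ℕ), N ≤ n → ∀ G : SimpleGraph (Fin n),
      d1SetE (graphonOf G) (closureP P) ≤ ENNReal.ofReal ε' →
      graphD1P G P ≤ ENNReal.ofReal ε

/-- A hereditary graph property: closed under induced subgraphs. -/
def Hereditary (P : GraphProp) : Prop :=
  ∀ (n : ℕ) (G : SimpleGraph (Fin n)), G ∈ P n →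
    ∀ (k : ℕ) (H : SimpleGraph (Fin k)), IsInducedSubgraph G H → H ∈ P k

/-- `U` is a flexing of `W`: `U ∈ W₀` agrees with `W` wherever `W` takes value `0` or `1`. -/
def Flexing (U W : ℝ → ℝ → ℝ) : Prop :=
  IsGraphon U ∧ ∀ x y, (W x y = 0 ∨ W x y = 1) → U x y = W x y

/-- A function property is flexible if it is preserved under flexing. -/
def FlexibleFamily (R : Set (ℝ → ℝ → ℝ)) : Prop :=
  ∀ W ∈ R, ∀ U, Flexing U W → U ∈ R

/-- `U' ≤ W'` almost everywhere on `[0,1]²`. -/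
def aeLE (U W : ℝ → ℝ → ℝ) : Prop :=
  ∀ᵐ p ∂(volume.restrict (I01 ×ˢ I01)), U p.1 p.2 ≤ W p.1 p.2

/-- `U ⪯ W`: up to isomorphism, `U ≤ W` almost everywhere. -/
def graphonLE (U W : ℝ → ℝ → ℝ) : Prop :=
  ∃ U' W', IsGraphon U' ∧ IsGraphon W' ∧ GraphonIso U U' ∧ GraphonIso W W' ∧ aeLE U' W'

/-- The upward closure of a graph property: graphs having a spanning subgraph in `P`. -/
def upP (P : GraphProp) : GraphProp :=
  fun n => {G | ∃ H : SimpleGraph (Fin n), H ∈ P n ∧ H ≤ G}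

/-- The upward closure of a function property. -/
def upR (R : Set (ℝ → ℝ → ℝ)) : Set (ℝ → ℝ → ℝ) :=
  {W | IsGraphon W ∧ ∃ U ∈ R, graphonLE U W}

/-- A stepfunction: constant on the products of a finite measurable partition of `[0,1]`. -/
def IsStepfunction (W : ℝ → ℝ → ℝ) : Prop :=
  ∃ (m : ℕ) (S : Fin m → Set ℝ), (∀ i, MeasurableSet (S i)) ∧
    (⋃ i, S i) = I01 ∧ (∀ i j, i ≠ j → Disjoint (S i) (S j)) ∧
    ∀ i j : Fin m, ∀ x ∈ S i, ∀ x' ∈ S i, ∀ y ∈ S j, ∀ y' ∈ S j, W x y = W x' y'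

open Classical in
/-- A testable graphon functional: its value can be estimated from `W`-random graphs. -/
def TestableFunctional (f : (ℝ → ℝ → ℝ) → ℝ) : Prop :=
  ∃ g : ∀ n : ℕ, SimpleGraph (Fin n) → ℝ,
    (∀ (n : ℕ) (G H : SimpleGraph (Fin n)), Nonempty (G ≃g H) → g n G = g n H) ∧
    ∀ ε : ℝ, 0 < ε → ∃ kε : ℕ, 1 ≤ kε ∧ ∀ k, kε ≤ k → ∀ W, IsGraphon W →
      (∑ F : SimpleGraph (Fin k), if ε < |f W - g k F| then indDensity F W else 0) < 1 / 3

/-- The uniform probability measure on `[0,1]`, as a measure on `ℝ`. -/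
abbrev muI : Measure ℝ := volume.restrict I01

instance muI_prob : IsProbabilityMeasure muI := by
  constructor
  simp [muI, I01]

/-- The law of a uniform sample. -/
abbrev muP (ι : Type) [Fintype ι] : Measure (ι → ℝ) := Measure.pi fun _ => muI

lemma cube_restrict (k : ℕ) :
    (volume.restrict (cube k) : Measure (Fin k → ℝ)) = muP (Fin k) := by
  unfold cube muP muI
  rw [volume_pi, Measure.restrict_pi_pi]

lemma int_bdd {X : Type*} [MeasurableSpace X] {ν : Measure X} [IsFiniteMeasure ν] {f : X → ℝ}
    (hf : Measurable f) (C : ℝ) (h : ∀ x, |f x| ≤ C) : Integrable f ν :=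
  Integrable.of_bound hf.aestronglyMeasurable C (ae_of_all _ h)

lemma abs_int_le {X : Type*} [MeasurableSpace X] {ν : Measure X} [IsProbabilityMeasure ν]
    {f : X → ℝ} (C : ℝ) (h : ∀ x, |f x| ≤ C) : |∫ x, f x ∂ν| ≤ C := by
  have := norm_integral_le_of_norm_le_const (μ := ν) (f := f) (C := C) (ae_of_all _ h)
  simpa using this

/-- Bounded measurable kernels. -/
def BK (D : ℝ → ℝ → ℝ) : Prop :=
  Measurable (Function.uncurry D) ∧ ∃ C, ∀ x y, |D x y| ≤ C

lemma BK.add {D E : ℝ → ℝ → ℝ} (h : BK D) (k : BK E) : BK (fun x y => D x y + E x y) := by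
  obtain ⟨h1, C, hC⟩ := h
  obtain ⟨k1, C', hC'⟩ := k
  exact ⟨h1.add k1, C + C', fun x y => (abs_add_le _ _).trans (add_le_add (hC x y) (hC' x y))⟩

lemma BK.mul {D E : ℝ → ℝ → ℝ} (h : BK D) (k : BK E) : BK (fun x y => D x y * E x y) := by
  obtain ⟨h1, C, hC⟩ := h
  obtain ⟨k1, C', hC'⟩ := k
  refine ⟨h1.mul k1, C * C', fun x y => ?_⟩
  rw [abs_mul]
  exact mul_le_mul (hC x y) (hC' x y) (abs_nonneg _) ((abs_nonneg _).trans (hC x y))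

lemma BK.neg {D : ℝ → ℝ → ℝ} (h : BK D) : BK (fun x y => - D x y) := by
  obtain ⟨h1, C, hC⟩ := h
  exact ⟨h1.neg, C, fun x y => by rw [abs_neg]; exact hC x y⟩

lemma BK.sub {D E : ℝ → ℝ → ℝ} (h : BK D) (k : BK E) : BK (fun x y => D x y - E x y) := by
  simpa [sub_eq_add_neg] using h.add k.neg

lemma BK.const (c : ℝ) : BK (fun _ _ => c) := ⟨measurable_const, |c|, fun _ _ => le_rfl⟩

lemma BK.abs {D : ℝ → ℝ → ℝ} (h : BK D) : BK (fun x y => |D x y|) := by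
  obtain ⟨h1, C, hC⟩ := h
  refine ⟨?_, C, fun x y => by rw [abs_abs]; exact hC x y⟩
  exact continuous_abs.measurable.comp h1

lemma BK.fst {f : ℝ → ℝ} (hf : Measurable f) (hb : ∀ x, |f x| ≤ 1) : BK (fun x _ => f x) :=
  ⟨hf.comp measurable_fst, 1, fun x _ => hb x⟩

lemma BK.snd {f : ℝ → ℝ} (hf : Measurable f) (hb : ∀ x, |f x| ≤ 1) : BK (fun _ y => f y) :=
  ⟨hf.comp measurable_snd, 1, fun _ y => hb y⟩

lemma BK.step {ι : Type} [Fintype ι] [MeasurableSpace ι] [MeasurableSingletonClass ι]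
    {b : ℝ → ι} (hb : Measurable b) (M : ι → ι → ℝ) : BK (fun x y => M (b x) (b y)) := by
  refine ⟨?_, ∑ i, ∑ j, |M i j|, fun x y => ?_⟩
  · have : Measurable (fun p : ι × ι => M p.1 p.2) := measurable_of_finite _
    exact this.comp ((hb.comp measurable_fst).prodMk (hb.comp measurable_snd))
  · calc |M (b x) (b y)| ≤ ∑ j, |M (b x) j| :=
        Finset.single_le_sum (f := fun j => |M (b x) j|) (fun _ _ => abs_nonneg _) (Finset.mem_univ _)
      _ ≤ _ := Finset.single_le_sum (f := fun i => ∑ j, |M i j|)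
          (fun _ _ => Finset.sum_nonneg fun _ _ => abs_nonneg _) (Finset.mem_univ _)

lemma BK.graphon {W : ℝ → ℝ → ℝ} (h : IsGraphon W) : BK W :=
  ⟨h.1, 1, fun x y => by
    have := h.2.2 x y
    rw [abs_of_nonneg this.1]; exact this.2⟩

lemma BK.integrable {D : ℝ → ℝ → ℝ} (h : BK D) :
    Integrable (fun p : ℝ × ℝ => D p.1 p.2) (muI.prod muI) := by
  obtain ⟨h1, C, hC⟩ := h
  exact int_bdd h1 C fun p => hC _ _

lemma l1Norm_eq {D : ℝ → ℝ → ℝ} (h : BK D) :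
    l1Norm D = ∫ p, |D p.1 p.2| ∂(muI.prod muI) := by
  unfold l1Norm
  rw [integral_prod _ h.abs.integrable]

/-- `D` has cut norm at most `δ`, tested against functions bounded by one. -/
def Reg (D : ℝ → ℝ → ℝ) (δ : ℝ) : Prop :=
  ∀ f g : ℝ → ℝ, Measurable f → Measurable g → (∀ x, |f x| ≤ 1) → (∀ x, |g x| ≤ 1) →
    |∫ p, D p.1 p.2 * f p.1 * g p.2 ∂(muI.prod muI)| ≤ δ

lemma BK.fg {D : ℝ → ℝ → ℝ} (h : BK D) {f g : ℝ → ℝ} (hf : Measurable f) (hg : Measurable g)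
    (hf1 : ∀ x, |f x| ≤ 1) (hg1 : ∀ x, |g x| ≤ 1) :
    Integrable (fun p : ℝ × ℝ => D p.1 p.2 * f p.1 * g p.2) (muI.prod muI) :=
  ((h.mul (BK.fst hf hf1)).mul (BK.snd hg hg1)).integrable

lemma Reg.nonneg {D : ℝ → ℝ → ℝ} {δ : ℝ} (h : Reg D δ) : 0 ≤ δ :=
  (abs_nonneg _).trans (h 0 0 measurable_const measurable_const (by simp) (by simp))

lemma Reg.mono {D : ℝ → ℝ → ℝ} {δ δ' : ℝ} (h : Reg D δ) (hd : δ ≤ δ') : Reg D δ' :=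
  fun f g a b c d => (h f g a b c d).trans hd

lemma Reg.add {D E : ℝ → ℝ → ℝ} {δ δ' : ℝ} (hD : BK D) (hE : BK E) (h : Reg D δ) (k : Reg E δ') :
    Reg (fun x y => D x y + E x y) (δ + δ') := by
  intro f g a b c d
  have : ∫ p, (D p.1 p.2 + E p.1 p.2) * f p.1 * g p.2 ∂(muI.prod muI)
      = ∫ p, D p.1 p.2 * f p.1 * g p.2 ∂(muI.prod muI)
        + ∫ p, E p.1 p.2 * f p.1 * g p.2 ∂(muI.prod muI) := by
    rw [← integral_add (hD.fg a b c d) (hE.fg a b c d)]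
    congr 1; ext p; ring
  rw [this]
  exact (abs_add_le _ _).trans (add_le_add (h f g a b c d) (k f g a b c d))

lemma Reg.neg {D : ℝ → ℝ → ℝ} {δ : ℝ} (h : Reg D δ) : Reg (fun x y => - D x y) δ := by
  intro f g a b c d
  have : ∫ p, (- D p.1 p.2) * f p.1 * g p.2 ∂(muI.prod muI)
      = - ∫ p, D p.1 p.2 * f p.1 * g p.2 ∂(muI.prod muI) := by
    rw [← integral_neg]
    congr 1; ext p; ring
  rw [this, abs_neg]
  exact h f g a b c d

lemma Reg.swap {A B : ℝ → ℝ → ℝ} {δ : ℝ} (h : Reg (fun x y => A x y - B x y) δ) :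
    Reg (fun x y => B x y - A x y) δ := by
  simpa using h.neg

lemma Reg.tri {A B C : ℝ → ℝ → ℝ} {δ δ' : ℝ} (hA : BK A) (hB : BK B) (hC : BK C)
    (h : Reg (fun x y => A x y - B x y) δ) (k : Reg (fun x y => B x y - C x y) δ') :
    Reg (fun x y => A x y - C x y) (δ + δ') := by
  simpa using h.add (hA.sub hB) (hB.sub hC) k

lemma Reg.of_l1 {D : ℝ → ℝ → ℝ} {δ : ℝ} (hD : BK D)
    (h : ∫ p, |D p.1 p.2| ∂(muI.prod muI) ≤ δ) : Reg D δ := by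
  intro f g a b c d
  refine (abs_integral_le_integral_abs).trans (le_trans ?_ h)
  refine integral_mono (hD.fg a b c d).abs hD.abs.integrable fun p => ?_
  simp only [abs_mul]
  have h1 := mul_le_mul_of_nonneg_left (c p.1) (abs_nonneg (D p.1 p.2))
  have h2 := mul_le_mul h1 (d p.2) (abs_nonneg _) (by simp)
  simpa using h2

lemma Reg.sum {ι : Type*} (s : Finset ι) {D : ι → ℝ → ℝ → ℝ} {δ : ι → ℝ} (hD : ∀ i, BK (D i))
    (h : ∀ i, Reg (D i) (δ i)) :
    BK (fun x y => ∑ i ∈ s, D i x y) ∧ Reg (fun x y => ∑ i ∈ s, D i x y) (∑ i ∈ s, δ i) := by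
  classical
  induction s using Finset.induction_on with
  | empty => refine ⟨by simpa using BK.const 0, ?_⟩; intro f g _ _ _ _; simp
  | insert i s hi ih =>
    simp only [Finset.sum_insert hi]
    exact ⟨(hD i).add ih.1, (h i).add (hD i) ih.1 ih.2⟩

lemma Reg.mul_fg {D : ℝ → ℝ → ℝ} {δ : ℝ} (h : Reg D δ) {u v : ℝ → ℝ} (hu : Measurable u)
    (hv : Measurable v) (hu1 : ∀ x, |u x| ≤ 1) (hv1 : ∀ x, |v x| ≤ 1) :
    Reg (fun x y => D x y * u x * v y) δ := by
  intro f g a b c d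
  have := h (fun x => u x * f x) (fun x => v x * g x) (hu.mul a) (hv.mul b)
    (fun x => by rw [abs_mul]; exact mul_le_one₀ (hu1 x) (abs_nonneg _) (c x))
    (fun x => by rw [abs_mul]; exact mul_le_one₀ (hv1 x) (abs_nonneg _) (d x))
  convert this using 3
  ext p; ring

lemma Reg.smul {D : ℝ → ℝ → ℝ} {δ : ℝ} (h : Reg D δ) {c : ℝ} (hc : |c| ≤ 1) :
    Reg (fun x y => c * D x y) δ := by
  have := h.mul_fg (u := fun _ => c) (v := fun _ => 1) measurable_const measurable_const
    (fun _ => hc) (by simp)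
  simpa [mul_comm] using this

open Classical in
lemma Reg.step_mul {ι : Type} [Fintype ι] [MeasurableSpace ι] [MeasurableSingletonClass ι]
    {b : ℝ → ι} (hb : Measurable b) {M : ι → ι → ℝ} (hM : ∀ i j, |M i j| ≤ 1)
    {D : ℝ → ℝ → ℝ} {δ : ℝ} (hD : BK D) (h : Reg D δ) :
    Reg (fun x y => M (b x) (b y) * D x y) ((Fintype.card ι : ℝ) ^ 2 * δ) := by
  have hm : ∀ i, Measurable (fun x => if b x = i then (1 : ℝ) else 0) := fun i =>
    Measurable.ite (hb (measurableSet_singleton i)) measurable_const measurable_const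
  have hm1 : ∀ i x, |if b x = i then (1 : ℝ) else 0| ≤ 1 := fun i x => by split_ifs <;> simp
  have key := Reg.sum (Finset.univ : Finset (ι × ι))
    (D := fun q x y => M q.1 q.2 * (D x y * (if b x = q.1 then (1 : ℝ) else 0)
      * (if b y = q.2 then (1 : ℝ) else 0))) (δ := fun _ => δ)
    (fun q => (BK.const _).mul ((hD.mul (BK.fst (hm q.1) (hm1 _))).mul (BK.snd (hm q.2) (hm1 _))))
    (fun q => (h.mul_fg (hm q.1) (hm q.2) (hm1 _) (hm1 _)).smul (hM _ _))
  have e : (fun x y => M (b x) (b y) * D x y) = fun x y => ∑ q : ι × ι,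
      M q.1 q.2 * (D x y * (if b x = q.1 then (1 : ℝ) else 0)
      * (if b y = q.2 then (1 : ℝ) else 0)) := by
    ext x y
    rw [Fintype.sum_prod_type]
    simp
  rw [e]
  convert key.2 using 1
  simp [pow_two]

/-- Sign of a boolean. -/
def sgB (s : Bool) : ℝ := if s then 1 else -1

lemma sgB_abs (s : Bool) : |sgB s| = 1 := by cases s <;> simp [sgB]

lemma sgB_meas {s : ℝ → Bool} (hs : Measurable s) : Measurable (fun x => sgB (s x)) :=
  (measurable_of_finite sgB).comp hs

lemma signpick {h f : ℝ → ℝ} (hh : Measurable h) (hb : ∃ C, ∀ x, |h x| ≤ C)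
    (hf1 : ∀ x, |f x| ≤ 1) :
    ∃ s : ℝ → Bool, Measurable s ∧ |∫ x, h x * f x ∂muI| ≤ ∫ x, h x * sgB (s x) ∂muI := by
  obtain ⟨C, hC⟩ := hb
  refine ⟨fun x => if 0 ≤ h x then true else false, ?_, ?_⟩
  · exact Measurable.ite (measurableSet_le measurable_const hh) measurable_const measurable_const
  · have e : (fun x => h x * sgB (if 0 ≤ h x then true else false)) = fun x => |h x| := by
      ext x
      by_cases hx : 0 ≤ h x
      · simp [sgB, hx, abs_of_nonneg hx]
      · simp [sgB, hx, abs_of_neg (not_le.mp hx)]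
    rw [e]
    have hi : Integrable (fun x => |h x|) muI :=
      int_bdd (continuous_abs.measurable.comp hh) C fun x => by simpa using hC x
    refine norm_integral_le_of_norm_le (f := fun x => h x * f x) hi (ae_of_all _ fun x => ?_)
    simp only [Real.norm_eq_abs, abs_mul]
    simpa using mul_le_mul_of_nonneg_left (hf1 x) (abs_nonneg (h x))

lemma BK.int_right {D : ℝ → ℝ → ℝ} (hD : BK D) :
    Measurable (fun x => ∫ y, D x y ∂muI) ∧ ∃ C, ∀ x, |∫ y, D x y ∂muI| ≤ C := by
  obtain ⟨h1, C, hC⟩ := hD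
  refine ⟨?_, C, fun x => abs_int_le C (hC x)⟩
  exact (h1.stronglyMeasurable.integral_prod_right (ν := muI)).measurable

lemma BK.flip {D : ℝ → ℝ → ℝ} (hD : BK D) : BK (fun x y => D y x) := by
  obtain ⟨h1, C, hC⟩ := hD
  exact ⟨h1.comp measurable_swap, C, fun x y => hC y x⟩

lemma reg_sign {D : ℝ → ℝ → ℝ} {δ : ℝ} (hD : BK D) (h : ¬ Reg D δ) :
    ∃ s s' : ℝ → Bool, Measurable s ∧ Measurable s' ∧
      δ < ∫ p, D p.1 p.2 * sgB (s p.1) * sgB (s' p.2) ∂(muI.prod muI) := by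
  unfold Reg at h
  push Not at h
  obtain ⟨f, g, hf, hg, hf1, hg1, hlt⟩ := h
  have hDg : BK (fun x y => D x y * g y) := hD.mul (BK.snd hg hg1)
  obtain ⟨s, hs, hs2⟩ := signpick (h := fun x => ∫ y, D x y * g y ∂muI) (f := f)
    hDg.int_right.1 hDg.int_right.2 hf1
  have hsm := sgB_meas hs
  have hsb : ∀ x, |sgB (s x)| ≤ 1 := fun x => (sgB_abs _).le
  have hDs : BK (fun x y => D y x * sgB (s y)) := hD.flip.mul (BK.snd hsm hsb)
  obtain ⟨s', hs', hs2'⟩ := signpick (h := fun y => ∫ x, D x y * sgB (s x) ∂muI) (f := g)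
    hDs.int_right.1 hDs.int_right.2 hg1
  have hsm' := sgB_meas hs'
  have hsb' : ∀ x, |sgB (s' x)| ≤ 1 := fun x => (sgB_abs _).le
  refine ⟨s, s', hs, hs', hlt.trans_le ?_⟩
  have e1 : ∀ u : ℝ → ℝ, Measurable u → (∀ x, |u x| ≤ 1) →
      ∫ p, D p.1 p.2 * u p.1 * g p.2 ∂(muI.prod muI)
        = ∫ x, (∫ y, D x y * g y ∂muI) * u x ∂muI := by
    intro u hu hu1
    rw [integral_prod _ (hD.fg hu hg hu1 hg1)]
    congr 1; ext x
    rw [← integral_mul_const]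
    congr 1; ext y; ring
  have e2 : ∀ u : ℝ → ℝ, Measurable u → (∀ x, |u x| ≤ 1) →
      ∫ p, D p.1 p.2 * sgB (s p.1) * u p.2 ∂(muI.prod muI)
        = ∫ y, (∫ x, D x y * sgB (s x) ∂muI) * u y ∂muI := by
    intro u hu hu1
    rw [integral_prod_symm _ (hD.fg hsm hu hsb hu1)]
    congr 1; ext x
    rw [← integral_mul_const]
  rw [e1 f hf hf1]
  refine hs2.trans ?_
  rw [← e1 _ hsm hsb, e2 g hg hg1, e2 _ hsm' hsb']
  exact (le_abs_self _).trans hs2'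

/-- Clipping to `[0,1]`. -/
def clip (x : ℝ) : ℝ := max 0 (min 1 x)

lemma clip_mem (x : ℝ) : clip x ∈ Set.Icc (0 : ℝ) 1 := by
  unfold clip; constructor
  · exact le_max_left _ _
  · exact max_le zero_le_one (min_le_left _ _)

lemma clip_sq {v : ℝ} (hv : v ∈ Set.Icc (0 : ℝ) 1) (x : ℝ) : (v - clip x) ^ 2 ≤ (v - x) ^ 2 := by
  obtain ⟨h0, h1⟩ := hv
  unfold clip
  rcases le_total x 0 with h | h
  · rw [min_eq_right (by linarith), max_eq_left h]; nlinarith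
  · rcases le_total x 1 with h' | h'
    · rw [min_eq_right h', max_eq_right h]
    · rw [min_eq_left h', max_eq_right zero_le_one]; nlinarith

/-- Symmetric matrices with entries in `[0,1]`. -/
def SM {ι : Type} (M : ι → ι → ℝ) : Prop :=
  (∀ i j, M i j = M j i) ∧ ∀ i j, M i j ∈ Set.Icc (0 : ℝ) 1

lemma wr_improve {ω ρ : ℝ → ℝ → ℝ} (hω : IsGraphon ω) (hρ : IsGraphon ρ) {δ : ℝ}
    {m m' : ℕ} (hm : m * 4 = m') {b : ℝ → Fin m} (hb : Measurable b) {M : Fin m → Fin m → ℝ}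
    (hM : SM M) (hδ : 0 < δ) (h : ¬ Reg (fun x y => ω x y * (ρ x y - M (b x) (b y))) δ) :
    ∃ (b' : ℝ → Fin m') (M' : Fin m' → Fin m' → ℝ), Measurable b' ∧ SM M' ∧
      ∫ p, ω p.1 p.2 * (ρ p.1 p.2 - M' (b' p.1) (b' p.2)) ^ 2 ∂(muI.prod muI) ≤
      ∫ p, ω p.1 p.2 * (ρ p.1 p.2 - M (b p.1) (b p.2)) ^ 2 ∂(muI.prod muI) - δ ^ 2 := by
  have bω := BK.graphon hω
  have bρ := BK.graphon hρ
  have bD : BK (fun x y => ρ x y - M (b x) (b y)) := bρ.sub (BK.step hb M)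
  obtain ⟨s, s', hs, hs', hlt⟩ := reg_sign (bω.mul bD) h
  have hcard : Fintype.card (Fin m × Bool × Bool) = m' := by simp; omega
  let e : (Fin m × Bool × Bool) ≃ Fin m' := Fintype.equivFinOfCardEq hcard
  let θ : (Fin m × Bool × Bool) → (Fin m × Bool × Bool) → ℝ := fun a c =>
    (sgB a.2.1 * sgB c.2.2 + sgB a.2.2 * sgB c.2.1) / 2
  let M₁ : (Fin m × Bool × Bool) → (Fin m × Bool × Bool) → ℝ := fun a c =>
    M a.1 c.1 + δ * θ a c
  let b₁ : ℝ → Fin m × Bool × Bool := fun x => (b x, s x, s' x)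
  have hb₁ : Measurable b₁ := hb.prodMk (hs.prodMk hs')
  refine ⟨fun x => e (b₁ x), fun i j => clip (M₁ (e.symm i) (e.symm j)),
    (measurable_of_finite e).comp hb₁, ⟨?_, fun i j => clip_mem _⟩, ?_⟩
  · intro i j
    show clip (M₁ _ _) = clip (M₁ _ _)
    congr 1
    show M _ _ + _ = M _ _ + _
    rw [hM.1]
    simp only [θ]; ring
  · simp only [Equiv.symm_apply_apply]
    have bM₁ : BK (fun x y => M₁ (b₁ x) (b₁ y)) := BK.step hb₁ M₁
    have bM₂ : BK (fun x y => clip (M₁ (b₁ x) (b₁ y))) := BK.step hb₁ fun i j => clip (M₁ i j)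
    have bθ : BK (fun x y => θ (b₁ x) (b₁ y)) := BK.step hb₁ θ
    have hθ : ∀ a c, (θ a c) ^ 2 ≤ 1 := by
      rintro ⟨a, a1, a2⟩ ⟨c, c1, c2⟩
      simp only [θ]
      cases a1 <;> cases a2 <;> cases c1 <;> cases c2 <;> norm_num [sgB]
    have i1 := bω.mul ((bρ.sub bM₂).mul (bρ.sub bM₂))
    have i2 := bω.mul ((bρ.sub bM₁).mul (bρ.sub bM₁))
    have i3 := bω.mul (bD.mul bD)
    have i4 := (bω.mul bD).mul bθ
    have s1 : ∫ p, ω p.1 p.2 * (ρ p.1 p.2 - clip (M₁ (b₁ p.1) (b₁ p.2))) ^ 2 ∂(muI.prod muI)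
        ≤ ∫ p, (ω p.1 p.2 * ((ρ p.1 p.2 - M (b p.1) (b p.2)) * (ρ p.1 p.2 - M (b p.1) (b p.2)))
          - 2 * δ * (ω p.1 p.2 * (ρ p.1 p.2 - M (b p.1) (b p.2)) * θ (b₁ p.1) (b₁ p.2))
          + δ ^ 2) ∂(muI.prod muI) := by
      refine integral_mono ?_ ?_ ?_
      · simpa only [pow_two] using i1.integrable
      · exact ((i3.sub ((BK.const (2 * δ)).mul i4)).add (BK.const (δ ^ 2))).integrable
      · intro p
        have h0 := (hω.2.2 p.1 p.2)
        have h1 := mul_le_mul_of_nonneg_left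
          (clip_sq (hρ.2.2 p.1 p.2) (M₁ (b₁ p.1) (b₁ p.2))) h0.1
        have h2 : ω p.1 p.2 * (θ (b₁ p.1) (b₁ p.2)) ^ 2 ≤ 1 :=
          mul_le_one₀ h0.2 (sq_nonneg _) (hθ _ _)
        have h3 := mul_le_mul_of_nonneg_left h2 (sq_nonneg δ)
        have h4 : M₁ (b₁ p.1) (b₁ p.2) = M (b p.1) (b p.2) + δ * θ (b₁ p.1) (b₁ p.2) := rfl
        refine h1.trans ?_
        rw [h4]
        simp only
        nlinarith [h3]
    refine s1.trans ?_
    rw [integral_add, integral_sub, integral_const_mul]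
    rotate_left
    · exact i3.integrable
    · exact ((BK.const (2 * δ)).mul i4).integrable
    · exact (i3.sub ((BK.const (2 * δ)).mul i4)).integrable
    · exact (BK.const (δ ^ 2)).integrable
    have hsm := sgB_meas hs
    have hsb : ∀ x, |sgB (s x)| ≤ 1 := fun x => (sgB_abs _).le
    have hsm' := sgB_meas hs'
    have hsb' : ∀ x, |sgB (s' x)| ≤ 1 := fun x => (sgB_abs _).le
    have s2 : ∫ p, ω p.1 p.2 * (ρ p.1 p.2 - M (b p.1) (b p.2)) * θ (b₁ p.1) (b₁ p.2)
          ∂(muI.prod muI) =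
        ∫ p, ω p.1 p.2 * (ρ p.1 p.2 - M (b p.1) (b p.2)) * sgB (s p.1) * sgB (s' p.2)
          ∂(muI.prod muI) := by
      have sw : ∫ p, ω p.1 p.2 * (ρ p.1 p.2 - M (b p.1) (b p.2)) * sgB (s' p.1) * sgB (s p.2)
          ∂(muI.prod muI) =
          ∫ p, ω p.1 p.2 * (ρ p.1 p.2 - M (b p.1) (b p.2)) * sgB (s p.1) * sgB (s' p.2)
          ∂(muI.prod muI) := by
        rw [← integral_prod_swap]
        congr 1; ext p
        simp only [Prod.fst_swap, Prod.snd_swap]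
        rw [hω.2.1 p.2 p.1, hρ.2.1 p.2 p.1, hM.1 (b p.2)]
        ring
      have : ∀ p : ℝ × ℝ, ω p.1 p.2 * (ρ p.1 p.2 - M (b p.1) (b p.2)) * θ (b₁ p.1) (b₁ p.2) =
        2⁻¹ * (ω p.1 p.2 * (ρ p.1 p.2 - M (b p.1) (b p.2)) * sgB (s p.1) * sgB (s' p.2)) +
        2⁻¹ * (ω p.1 p.2 * (ρ p.1 p.2 - M (b p.1) (b p.2)) * sgB (s' p.1) * sgB (s p.2)) := by
        intro p; simp only [θ, b₁]; ring
      simp only [this]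
      rw [integral_add, integral_const_mul, integral_const_mul, sw]
      · ring
      · exact ((bω.mul bD).fg hsm hsm' hsb hsb').const_mul _
      · exact ((bω.mul bD).fg hsm' hsm hsb' hsb).const_mul _
    rw [s2]
    simp only [pow_two] at *
    simp only [integral_const, probReal_univ, smul_eq_mul, one_mul]
    nlinarith [hlt]

/-- Weighted weak regularity lemma. -/
lemma weak_reg (δ : ℝ) (hδ : 0 < δ) : ∃ K : ℕ, 0 < K ∧ ∀ ω ρ : ℝ → ℝ → ℝ, IsGraphon ω →
    IsGraphon ρ → ∃ (b : ℝ → Fin K) (M : Fin K → Fin K → ℝ), Measurable b ∧ SM M ∧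
      Reg (fun x y => ω x y * (ρ x y - M (b x) (b y))) δ := by
  obtain ⟨T, hT⟩ := exists_nat_gt (1 / δ ^ 2)
  refine ⟨4 ^ T, by positivity, fun ω ρ hω hρ => ?_⟩
  have bω := BK.graphon hω
  have bρ := BK.graphon hρ
  have main : ∀ i : ℕ, ∃ (b : ℝ → Fin (4 ^ i)) (M : Fin (4 ^ i) → Fin (4 ^ i) → ℝ),
      Measurable b ∧ SM M ∧ (Reg (fun x y => ω x y * (ρ x y - M (b x) (b y))) δ ∨
      ∫ p, ω p.1 p.2 * (ρ p.1 p.2 - M (b p.1) (b p.2)) ^ 2 ∂(muI.prod muI) ≤ 1 - i * δ ^ 2) := by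
    intro i
    induction i with
    | zero =>
      refine ⟨fun _ => ⟨0, by simp⟩, fun _ _ => 0, measurable_const, ⟨fun _ _ => rfl, by simp⟩,
        Or.inr ?_⟩
      have := abs_int_le (ν := muI.prod muI)
        (f := fun p : ℝ × ℝ => ω p.1 p.2 * (ρ p.1 p.2 - 0) ^ 2) 1 (by
          intro p
          have h1 := hω.2.2 p.1 p.2
          have h2 := hρ.2.2 p.1 p.2
          rw [sub_zero, abs_of_nonneg (mul_nonneg h1.1 (sq_nonneg _))]
          exact mul_le_one₀ h1.2 (sq_nonneg _) (pow_le_one₀ h2.1 h2.2))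
      simpa using (le_abs_self _).trans this
    | succ i ih =>
      obtain ⟨b, M, hb, hM, hor⟩ := ih
      by_cases hreg : Reg (fun x y => ω x y * (ρ x y - M (b x) (b y))) δ
      · have hcard : 4 ^ i ≤ 4 ^ (i + 1) := Nat.pow_le_pow_right (by norm_num) (by omega)
        have hcard : Fintype.card (Fin (4 ^ i) × Fin 4) = 4 ^ (i + 1) := by simp [pow_succ]
        let e : (Fin (4 ^ i) × Fin 4) ≃ Fin (4 ^ (i + 1)) := Fintype.equivFinOfCardEq hcard
        refine ⟨fun x => e (b x, 0), fun j k => M (e.symm j).1 (e.symm k).1,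
          (measurable_of_finite e).comp (hb.prodMk measurable_const),
          ⟨fun _ _ => hM.1 _ _, fun _ _ => hM.2 _ _⟩, Or.inl ?_⟩
        simpa using hreg
      · have herr := hor.resolve_left hreg
        obtain ⟨b', M', hb', hM', hle⟩ := wr_improve (m' := 4 ^ (i + 1)) hω hρ
          (pow_succ 4 i).symm hb hM hδ hreg
        refine ⟨b', M', hb', hM', Or.inr (hle.trans ?_)⟩
        push_cast
        linarith
  obtain ⟨b, M, hb, hM, hor⟩ := main T
  refine ⟨b, M, hb, hM, hor.resolve_right fun hle => ?_⟩
  have h0 : 0 ≤ ∫ p, ω p.1 p.2 * (ρ p.1 p.2 - M (b p.1) (b p.2)) ^ 2 ∂(muI.prod muI) :=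
    integral_nonneg fun p => mul_nonneg (hω.2.2 _ _).1 (sq_nonneg _)
  rw [div_lt_iff₀ (by positivity)] at hT
  linarith

lemma mp_update {ι : Type} [Fintype ι] [DecidableEq ι] (i : ι) :
    MeasurePreserving (fun p : (ι → ℝ) × ℝ => Function.update p.1 i p.2)
      ((muP ι).prod muI) (muP ι) := by
  have hmeas : Measurable (fun p : (ι → ℝ) × ℝ => Function.update p.1 i p.2) := by
    refine measurable_pi_lambda _ fun j => ?_
    by_cases h : j = i
    · subst h; simpa using measurable_snd
    · simp only [Function.update_of_ne h]
      exact (measurable_pi_apply j).comp measurable_fst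
  refine ⟨hmeas, ?_⟩
  refine (Measure.pi_eq fun s hs => ?_).symm
  rw [Measure.map_apply hmeas (MeasurableSet.univ_pi hs)]
  have : (fun p : (ι → ℝ) × ℝ => Function.update p.1 i p.2) ⁻¹' (Set.univ.pi s) =
      (Set.univ.pi (Function.update s i Set.univ)) ×ˢ (s i) := by
    ext p
    simp only [Set.mem_preimage, Set.mem_pi, Set.mem_univ, true_imp_iff, Set.mem_prod]
    constructor
    · intro h
      refine ⟨fun j => ?_, by simpa using h i⟩
      by_cases hj : j = i
      · subst hj; simp
      · simpa [Function.update_of_ne hj] using h j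
    · rintro ⟨h, h'⟩ j
      by_cases hj : j = i
      · subst hj; simpa using h'
      · simpa [Function.update_of_ne hj] using h j
  rw [this, Measure.prod_prod, Measure.pi_pi, ← Finset.mul_prod_erase _ _ (Finset.mem_univ i),
    ← Finset.mul_prod_erase (Finset.univ) (fun j => muI (s j)) (Finset.mem_univ i)]
  simp only [Function.update_self, measure_univ, one_mul]
  rw [mul_comm]
  congr 1
  refine Finset.prod_congr rfl fun j hj => ?_
  rw [Function.update_of_ne (Finset.ne_of_mem_erase hj)]

lemma resample {ι : Type} [Fintype ι] [DecidableEq ι] (i : ι) {φ : (ι → ℝ) → ℝ}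
    (hφ : Measurable φ) (C : ℝ) (hC : ∀ x, |φ x| ≤ C) :
    ∫ x, φ x ∂(muP ι) = ∫ x, ∫ u, φ (Function.update x i u) ∂muI ∂(muP ι) := by
  have mp := mp_update i
  rw [← mp.map_eq, integral_map mp.measurable.aemeasurable hφ.aestronglyMeasurable,
    integral_prod, mp.map_eq]
  exact int_bdd (hφ.comp mp.measurable) C fun _ => hC _

/-- Integrating a kernel of small cut norm against two functions each missing a coordinate. -/
lemma pair_bound {ι : Type} [Fintype ι] [DecidableEq ι] {i j : ι} (hij : i ≠ j)
    {D : ℝ → ℝ → ℝ} {δ : ℝ} (hD : BK D) (h : Reg D δ) {f g : (ι → ℝ) → ℝ}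
    (hf : Measurable f) (hg : Measurable g) (hf1 : ∀ x, |f x| ≤ 1) (hg1 : ∀ x, |g x| ≤ 1)
    (hfj : ∀ x u, f (Function.update x j u) = f x) (hgi : ∀ x u, g (Function.update x i u) = g x) :
    |∫ x, D (x i) (x j) * f x * g x ∂(muP ι)| ≤ δ := by
  have hD' := hD
  obtain ⟨hDm, C, hC⟩ := hD'
  have hC0 : 0 ≤ C := (abs_nonneg _).trans (hC 0 0)
  have hm : Measurable (fun x : ι → ℝ => D (x i) (x j) * f x * g x) :=
    (Measurable.mul (f := fun x : ι → ℝ => D (x i) (x j)) (hDm.comp (f := fun x : ι → ℝ => (x i, x j))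
      ((measurable_pi_apply i).prodMk (measurable_pi_apply j))) hf).mul hg
  have hb : ∀ x : ι → ℝ, |D (x i) (x j) * f x * g x| ≤ C := by
    intro x
    rw [abs_mul, abs_mul]
    have h1 := mul_le_mul (hC (x i) (x j)) (hf1 x) (abs_nonneg _) hC0
    have h2 := mul_le_mul h1 (hg1 x) (abs_nonneg _) (by simpa using hC0)
    simpa using h2
  have hupd : ∀ k : ι, Measurable (fun p : (ι → ℝ) × ℝ => Function.update p.1 k p.2) :=
    fun k => (mp_update k).measurable
  rw [resample i hm C hb]
  have hm2 : Measurable (fun x : ι → ℝ => ∫ u, D (Function.update x i u i) (Function.update x i u j)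
      * f (Function.update x i u) * g (Function.update x i u) ∂muI) := by
    have := (hm.comp (hupd i)).stronglyMeasurable.integral_prod_right' (ν := muI)
    exact this.measurable
  rw [resample j hm2 C (fun x => abs_int_le C fun u => hb _)]
  refine abs_int_le δ fun x => ?_
  have hu : ∀ k : ι, ∀ x : ι → ℝ, Measurable (fun u : ℝ => Function.update x k u) := fun k x =>
    (hupd k).comp (measurable_const.prodMk measurable_id)
  have key := h (fun u => f (Function.update x i u)) (fun v => g (Function.update x j v))
    (hf.comp (hu i x)) (hg.comp (hu j x)) (fun _ => hf1 _) (fun _ => hg1 _)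
  have e : ∫ v, ∫ u, D (Function.update (Function.update x j v) i u i)
      (Function.update (Function.update x j v) i u j)
      * f (Function.update (Function.update x j v) i u)
      * g (Function.update (Function.update x j v) i u) ∂muI ∂muI =
      ∫ p, D p.1 p.2 * f (Function.update x i p.1) * g (Function.update x j p.2)
        ∂(muI.prod muI) := by
    rw [integral_prod_symm _ (hD.fg (f := fun u => f (Function.update x i u))
      (g := fun v => g (Function.update x j v)) (hf.comp (hu i x)) (hg.comp (hu j x))
      (fun _ => hf1 _) (fun _ => hg1 _))]
    congr 1; ext v; congr 1; ext u
    rw [hgi, Function.update_comm hij.symm, hfj]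
    simp only [Function.update_self]
    rw [Function.update_comm hij, Function.update_self]
  rw [e]
  exact key

/-- Unit interval valued kernels. -/
def UK (W : ℝ → ℝ → ℝ) : Prop :=
  Measurable (Function.uncurry W) ∧ ∀ x y, W x y ∈ Set.Icc (0 : ℝ) 1

lemma UK.bk {W : ℝ → ℝ → ℝ} (h : UK W) : BK W :=
  ⟨h.1, 1, fun x y => by
    have := h.2 x y
    rw [abs_of_nonneg this.1]; exact this.2⟩

lemma IsGraphon.uk {W : ℝ → ℝ → ℝ} (h : IsGraphon W) : UK W := ⟨h.1, h.2.2⟩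

open Classical in
/-- The factor of the pair `e` in the induced density. -/
def fac {k : ℕ} (F : SimpleGraph (Fin k)) (W : ℝ → ℝ → ℝ) (e : Fin k × Fin k) (x : Fin k → ℝ) : ℝ :=
  if e.1 < e.2 then (if F.Adj e.1 e.2 then W (x e.1) (x e.2) else 1 - W (x e.1) (x e.2)) else 1

lemma fac_mem {k : ℕ} (F : SimpleGraph (Fin k)) {W : ℝ → ℝ → ℝ} (hW : UK W) (e : Fin k × Fin k)
    (x : Fin k → ℝ) : fac F W e x ∈ Set.Icc (0 : ℝ) 1 := by
  have := hW.2 (x e.1) (x e.2)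
  unfold fac
  split_ifs
  · exact this
  · exact ⟨by linarith [this.2], by linarith [this.1]⟩
  · simp

lemma fac_meas {k : ℕ} (F : SimpleGraph (Fin k)) {W : ℝ → ℝ → ℝ} (hW : UK W) (e : Fin k × Fin k) :
    Measurable (fac F W e) := by
  have : Measurable (fun x : Fin k → ℝ => W (x e.1) (x e.2)) :=
    hW.1.comp (f := fun x : Fin k → ℝ => (x e.1, x e.2)) ((measurable_pi_apply e.1).prodMk (measurable_pi_apply e.2))
  unfold fac
  split_ifs
  · exact this
  · exact measurable_const.sub this
  · exact measurable_const

lemma fac_update {k : ℕ} (F : SimpleGraph (Fin k)) (W : ℝ → ℝ → ℝ) (e : Fin k × Fin k)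
    (x : Fin k → ℝ) (j : Fin k) (u : ℝ) (h1 : e.1 ≠ j) (h2 : e.2 ≠ j) :
    fac F W e (Function.update x j u) = fac F W e x := by
  unfold fac
  simp [Function.update_of_ne h1, Function.update_of_ne h2]

lemma indDensity_eq {k : ℕ} (F : SimpleGraph (Fin k)) (W : ℝ → ℝ → ℝ) :
    indDensity F W = ∫ x, ∏ e, fac F W e x ∂(muP (Fin k)) := by
  unfold indDensity
  rw [cube_restrict]
  congr 1; ext x
  rw [Fintype.prod_prod_type]
  rfl

lemma prod01 {ι : Type*} (s : Finset ι) {u : ι → ℝ} (h : ∀ i, u i ∈ Set.Icc (0 : ℝ) 1) :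
    |∏ i ∈ s, u i| ≤ 1 := by
  rw [abs_of_nonneg (Finset.prod_nonneg fun i _ => (h i).1)]
  exact Finset.prod_le_one (fun i _ => (h i).1) fun i _ => (h i).2

lemma counting {k : ℕ} (F : SimpleGraph (Fin k)) {W W' : ℝ → ℝ → ℝ} (hW : UK W) (hW' : UK W')
    {δ : ℝ} (h : Reg (fun x y => W x y - W' x y) δ) :
    |indDensity F W - indDensity F W'| ≤ (k : ℝ) ^ 2 * δ := by
  classical
  have hδ := h.nonneg
  let hy : Finset (Fin k × Fin k) → (Fin k × Fin k) → (Fin k → ℝ) → ℝ := fun S e x =>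
    if e ∈ S then fac F W e x else fac F W' e x
  have hy01 : ∀ S e x, hy S e x ∈ Set.Icc (0 : ℝ) 1 := by
    intro S e x; simp only [hy]; split_ifs
    · exact fac_mem F hW e x
    · exact fac_mem F hW' e x
  have hym : ∀ S e, Measurable (hy S e) := by
    intro S e; simp only [hy]; split_ifs
    · exact fac_meas F hW e
    · exact fac_meas F hW' e
  have hyu : ∀ S (e : Fin k × Fin k) x j u, e.1 ≠ j → e.2 ≠ j →
      hy S e (Function.update x j u) = hy S e x := by
    intro S e x j u h1 h2
    simp only [hy, fac_update F _ e x j u h1 h2]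
  have hint : ∀ S, Integrable (fun x => ∏ e, hy S e x) (muP (Fin k)) := fun S =>
    int_bdd (Finset.measurable_fun_prod _ fun e _ => hym S e) 1 fun x => prod01 _ fun e => hy01 S e x
  have main : ∀ S : Finset (Fin k × Fin k),
      |∫ x, ∏ e, hy S e x ∂(muP (Fin k)) - ∫ x, ∏ e, hy ∅ e x ∂(muP (Fin k))| ≤ S.card * δ := by
    intro S
    induction S using Finset.induction_on with
    | empty => simp
    | insert a S ha ih =>
      rw [Finset.card_insert_of_notMem ha]
      have step : |∫ x, ∏ e, hy (insert a S) e x ∂(muP (Fin k)) - ∫ x, ∏ e, hy S e x ∂(muP (Fin k))|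
          ≤ δ := by
        rw [← integral_sub (hint _) (hint _)]
        have e1 : ∀ x, ∏ e, hy (insert a S) e x - ∏ e, hy S e x =
            (fac F W a x - fac F W' a x) * ∏ e ∈ Finset.univ.erase a, hy S e x := by
          intro x
          rw [← Finset.mul_prod_erase _ _ (Finset.mem_univ a),
            ← Finset.mul_prod_erase _ (fun e => hy S e x) (Finset.mem_univ a)]
          have : ∏ e ∈ Finset.univ.erase a, hy (insert a S) e x
              = ∏ e ∈ Finset.univ.erase a, hy S e x := by
            refine Finset.prod_congr rfl fun e he => ?_
            have := Finset.ne_of_mem_erase he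
            simp [hy, this]
          rw [this]
          have h1 : hy (insert a S) a x = fac F W a x := by simp [hy]
          have h2 : hy S a x = fac F W' a x := by simp [hy, ha]
          rw [h1, h2]; ring
        simp only [e1]
        by_cases hlt : a.1 < a.2
        · have hDk : BK (fun x y => W x y - W' x y) := hW.bk.sub hW'.bk
          let cc : ℝ := if F.Adj a.1 a.2 then 1 else -1
          let P₁ := (Finset.univ.erase a).filter fun e : Fin k × Fin k => e.1 ≠ a.2 ∧ e.2 ≠ a.2
          let P₂ := (Finset.univ.erase a).filter fun e : Fin k × Fin k => ¬ (e.1 ≠ a.2 ∧ e.2 ≠ a.2)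
          have e2 : ∀ x, (fac F W a x - fac F W' a x) * ∏ e ∈ Finset.univ.erase a, hy S e x =
              (W (x a.1) (x a.2) - W' (x a.1) (x a.2)) * (cc * ∏ e ∈ P₁, hy S e x) *
              ∏ e ∈ P₂ with e.1 < e.2, hy S e x := by
            intro x
            have h3 : ∏ e ∈ P₂ with e.1 < e.2, hy S e x = ∏ e ∈ P₂, hy S e x := by
              refine Finset.prod_subset (Finset.filter_subset _ _) fun e he hne => ?_
              have : ¬ e.1 < e.2 := fun hh => hne (Finset.mem_filter.2 ⟨he, hh⟩)
              simp [hy, fac, this]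
            rw [h3, ← Finset.prod_filter_mul_prod_filter_not (Finset.univ.erase a)
              (fun e : Fin k × Fin k => e.1 ≠ a.2 ∧ e.2 ≠ a.2)]
            have h4 : fac F W a x - fac F W' a x
                = (W (x a.1) (x a.2) - W' (x a.1) (x a.2)) * cc := by
              simp only [fac, hlt, if_true, cc]
              split_ifs <;> ring
            rw [h4]; ring
          simp only [e2]
          refine pair_bound (ι := Fin k) hlt.ne hDk h
            (measurable_const.mul (Finset.measurable_fun_prod _ fun e _ => hym S e))
            (Finset.measurable_fun_prod _ fun e _ => hym S e) ?_ ?_ ?_ ?_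
          · intro x
            rw [abs_mul]
            have : |cc| = 1 := by simp only [cc]; split_ifs <;> simp
            rw [this, one_mul]
            exact prod01 _ fun e => hy01 S e x
          · intro x; exact prod01 _ fun e => hy01 S e x
          · intro x u
            congr 1
            refine Finset.prod_congr rfl fun e he => ?_
            have := (Finset.mem_filter.1 he).2
            exact hyu S e x _ u this.1 this.2
          · intro x u
            refine Finset.prod_congr rfl fun e he => ?_
            have h5 := (Finset.mem_filter.1 he)
            have h6 := (Finset.mem_filter.1 h5.1)
            have h7 := Finset.ne_of_mem_erase h6.1
            have h8 : e.1 ≠ a.1 ∧ e.2 ≠ a.1 := by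
              obtain ⟨a1, a2⟩ := a
              obtain ⟨e1, e2⟩ := e
              simp only [ne_eq, Prod.mk.injEq] at *
              grind
            exact hyu S e x _ u h8.1 h8.2
        · have : ∀ x, fac F W a x - fac F W' a x = 0 := by intro x; simp [fac, hlt]
          simp only [this, zero_mul, integral_zero, abs_zero]
          exact hδ
      have := abs_sub_le (∫ x, ∏ e, hy (insert a S) e x ∂(muP (Fin k)))
        (∫ x, ∏ e, hy S e x ∂(muP (Fin k))) (∫ x, ∏ e, hy ∅ e x ∂(muP (Fin k)))
      push_cast
      linarith
  have := main Finset.univ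
  rw [indDensity_eq, indDensity_eq]
  simpa [hy, pow_two] using this

lemma exists_sub {Q : Set ℝ} (hQ : MeasurableSet Q) {c : ℝ} (h0 : 0 ≤ c) (h1 : c ≤ muI.real Q) :
    ∃ A ⊆ Q, MeasurableSet A ∧ muI.real A = c := by
  let φ : ℝ → ℝ := fun t => muI.real (Q ∩ Set.Iic t)
  have hle : ∀ s t : ℝ, φ t ≤ φ s + dist t s := by
    intro s t
    have hsub : Q ∩ Set.Iic t ⊆ (Q ∩ Set.Iic s) ∪ Set.Ioc s t := by
      rintro x ⟨hx, hxt⟩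
      by_cases hs : x ≤ s
      · exact Or.inl ⟨hx, hs⟩
      · exact Or.inr ⟨not_le.1 hs, hxt⟩
    have h2 : muI.real (Set.Ioc s t) ≤ dist t s := by
      have h3 : muI (Set.Ioc s t) ≤ volume (Set.Ioc s t) := Measure.restrict_apply_le _ _
      rw [Real.volume_Ioc] at h3
      have := ENNReal.toReal_mono (by simp) h3
      rw [ENNReal.toReal_ofReal'] at this
      refine this.trans ?_
      rw [Real.dist_eq]
      exact max_le (le_abs_self _) (abs_nonneg _)
    exact (measureReal_mono hsub).trans ((measureReal_union_le _ _).trans (by linarith))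
  have hcont : Continuous φ := (LipschitzWith.of_le_add (fun x y => hle y x)).continuous
  have hlo : φ (-1) = 0 := by
    have : muI (Q ∩ Set.Iic (-1)) = 0 := by
      rw [Measure.restrict_apply (hQ.inter measurableSet_Iic)]
      convert measure_empty (μ := (volume : Measure ℝ))
      ext x; simp only [I01, Set.mem_inter_iff, Set.mem_Iic, Set.mem_Icc, Set.mem_empty_iff_false]
      constructor
      · rintro ⟨⟨_, h⟩, h', _⟩; linarith
      · tauto
    simp [φ, Measure.real, this]
  have hhi : φ 1 = muI.real Q := by
    simp only [φ, Measure.real]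
    congr 1
    rw [Measure.restrict_apply (hQ.inter measurableSet_Iic), Measure.restrict_apply hQ]
    congr 1
    ext x; simp only [I01, Set.mem_inter_iff, Set.mem_Iic, Set.mem_Icc]; tauto
  obtain ⟨t, -, ht⟩ := intermediate_value_Icc (a := (-1 : ℝ)) (b := 1) (by norm_num)
    hcont.continuousOn (show c ∈ Set.Icc (φ (-1)) (φ 1) by rw [hlo, hhi]; exact ⟨h0, h1⟩)
  exact ⟨Q ∩ Set.Iic t, Set.inter_subset_left, hQ.inter measurableSet_Iic, ht⟩

open Classical in
lemma split1 {ι : Type} [MeasurableSpace ι] [MeasurableSingletonClass ι] (s : Finset ι)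
    (hs : s.Nonempty) (p : ι → ℝ) (hp : ∀ i, 0 ≤ p i) :
    ∀ Q : Set ℝ, MeasurableSet Q → ∑ i ∈ s, p i = muI.real Q →
    ∃ h : ℝ → ι, Measurable h ∧ ∀ i, muI.real (Q ∩ h ⁻¹' {i}) = if i ∈ s then p i else 0 := by
  induction hs using Finset.Nonempty.cons_induction with
  | singleton a =>
    intro Q hQ hsum
    refine ⟨fun _ => a, measurable_const, fun i => ?_⟩
    by_cases h : i = a
    · subst h; simp at hsum ⊢; rw [hsum]
    · simp [h, Ne.symm h]
  | cons a s ha hs ih =>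
    intro Q hQ hsum
    rw [Finset.sum_cons] at hsum
    have hnn : 0 ≤ ∑ i ∈ s, p i := Finset.sum_nonneg fun i _ => hp i
    obtain ⟨A, hAQ, hA, hAp⟩ := exists_sub hQ (hp a) (by linarith)
    obtain ⟨h, hm, hh⟩ := ih (Q \ A) (hQ.diff hA) (by
      rw [measureReal_sdiff hAQ hA]; linarith)
    refine ⟨fun x => if x ∈ A then a else h x, Measurable.ite hA measurable_const hm, fun i => ?_⟩
    by_cases hi : i = a
    · subst hi
      have e : Q ∩ (fun x => if x ∈ A then i else h x) ⁻¹' {i} = A ∪ ((Q \ A) ∩ h ⁻¹' {i}) := by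
        ext x
        have := @hAQ x
        by_cases hx : x ∈ A <;> simp [hx] <;> tauto
      have hd : Disjoint A ((Q \ A) ∩ h ⁻¹' {i}) :=
        Set.disjoint_left.2 fun x hx hx' => hx'.1.2 hx
      rw [e, measureReal_union hd ((hQ.diff hA).inter (hm (measurableSet_singleton i))), hh, hAp]
      simp [ha]
    · have e : Q ∩ (fun x => if x ∈ A then a else h x) ⁻¹' {i} = ((Q \ A) ∩ h ⁻¹' {i}) := by
        ext x
        by_cases hx : x ∈ A <;> simp [hx, Ne.symm hi]
      rw [e, hh]
      simp [hi]

lemma split2 {α ι : Type} [Fintype α] [MeasurableSpace α] [MeasurableSingletonClass α]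
    [Fintype ι] [Nonempty ι] [MeasurableSpace ι] [MeasurableSingletonClass ι]
    {a : ℝ → α} (ha : Measurable a) (p : α → ι → ℝ) (hp : ∀ c i, 0 ≤ p c i)
    (hsum : ∀ c, ∑ i, p c i = muI.real (a ⁻¹' {c})) :
    ∃ h : ℝ → ι, Measurable h ∧ ∀ c i, muI.real (a ⁻¹' {c} ∩ h ⁻¹' {i}) = p c i := by
  choose h hm hh using fun c => split1 Finset.univ Finset.univ_nonempty (p c) (hp c) (a ⁻¹' {c})
    (ha (measurableSet_singleton c)) (hsum c)
  refine ⟨fun x => h (a x) x, ?_, fun c i => ?_⟩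
  · have : Measurable (fun q : α × ℝ => h q.1 q.2) := measurable_from_prod_countable_right hm
    exact this.comp (ha.prodMk measurable_id)
  · have : a ⁻¹' {c} ∩ (fun x => h (a x) x) ⁻¹' {i} = a ⁻¹' {c} ∩ (h c) ⁻¹' {i} := by
      ext x
      simp only [Set.mem_inter_iff, Set.mem_preimage, Set.mem_singleton_iff]
      constructor
      · rintro ⟨rfl, h2⟩; exact ⟨rfl, h2⟩
      · rintro ⟨rfl, h2⟩; exact ⟨rfl, h2⟩
    rw [this, hh]; simp

lemma same_law {κ : Type} [Fintype κ] [MeasurableSpace κ] [MeasurableSingletonClass κ]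
    {h₁ h₂ : ℝ → κ} (m₁ : Measurable h₁) (m₂ : Measurable h₂)
    (h : ∀ q, muI.real (h₁ ⁻¹' {q}) = muI.real (h₂ ⁻¹' {q})) : muI.map h₁ = muI.map h₂ := by
  refine Measure.ext_of_singleton fun q => ?_
  rw [Measure.map_apply m₁ (measurableSet_singleton q), Measure.map_apply m₂ (measurableSet_singleton q)]
  exact (measureReal_eq_measureReal_iff).1 (h q)

lemma sum_real_fiber {κ : Type} [Fintype κ] [MeasurableSpace κ] [MeasurableSingletonClass κ]
    {h : ℝ → κ} (m : Measurable h) {Q : Set ℝ} (hQ : MeasurableSet Q) :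
    ∑ q, muI.real (Q ∩ h ⁻¹' {q}) = muI.real Q := by
  rw [← measureReal_iUnion_fintype]
  · congr 1
    ext x; simp
  · intro i j hij
    refine Set.disjoint_left.2 fun x hx hx' => hij ?_
    exact hx.2.symm.trans hx'.2
  · exact fun i => hQ.inter (m (measurableSet_singleton i))

lemma transfer {ι κ : Type} [Fintype ι] [MeasurableSpace ι] [MeasurableSingletonClass ι]
    [Fintype κ] [Nonempty κ] [MeasurableSpace κ] [MeasurableSingletonClass κ]
    {s t : ℝ → ι} (hs : Measurable s) (ht : Measurable t)
    (hl : ∀ i, muI.real (s ⁻¹' {i}) = muI.real (t ⁻¹' {i})) {b : ℝ → κ} (hb : Measurable b) :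
    ∃ b' : ℝ → κ, Measurable b' ∧
      muI.map (fun x => (s x, b' x)) = muI.map (fun x => (t x, b x)) := by
  obtain ⟨b', hb', h⟩ := split2 hs (fun i c => muI.real (t ⁻¹' {i} ∩ b ⁻¹' {c}))
    (fun _ _ => measureReal_nonneg) (fun i => by
      rw [sum_real_fiber hb (ht (measurableSet_singleton i)), hl])
  refine ⟨b', hb', same_law (hs.prodMk hb') (ht.prodMk hb) fun q => ?_⟩
  have e : ∀ (u : ℝ → ι) (v : ℝ → κ), (fun x => (u x, v x)) ⁻¹' {q} = u ⁻¹' {q.1} ∩ v ⁻¹' {q.2} := by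
    intro u v; ext x; simp [Prod.ext_iff]
  rw [e, e, h]

lemma law_int {κ : Type} [Fintype κ] [MeasurableSpace κ] [MeasurableSingletonClass κ]
    {h₁ h₂ : ℝ → κ} (m₁ : Measurable h₁) (m₂ : Measurable h₂) (h : muI.map h₁ = muI.map h₂)
    (M : κ → κ → ℝ) :
    ∫ p, M (h₁ p.1) (h₁ p.2) ∂(muI.prod muI) = ∫ p, M (h₂ p.1) (h₂ p.2) ∂(muI.prod muI) := by
  have key : ∀ {g : ℝ → κ}, Measurable g → ∫ p, M (g p.1) (g p.2) ∂(muI.prod muI)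
      = ∫ q, M q.1 q.2 ∂((muI.map g).prod (muI.map g)) := by
    intro g hg
    rw [Measure.map_prod_map _ _ hg hg, integral_map]
    · rfl
    · exact (hg.prodMap hg).aemeasurable
    · exact (measurable_of_finite _).aestronglyMeasurable
  rw [key m₁, key m₂, h]

lemma law_ind {κ : Type} [Fintype κ] [MeasurableSpace κ] [MeasurableSingletonClass κ]
    {h₁ h₂ : ℝ → κ} (m₁ : Measurable h₁) (m₂ : Measurable h₂) (h : muI.map h₁ = muI.map h₂)
    (M : κ → κ → ℝ) {k : ℕ} (F : SimpleGraph (Fin k)) :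
    indDensity F (fun x y => M (h₁ x) (h₁ y)) = indDensity F (fun x y => M (h₂ x) (h₂ y)) := by
  classical
  have key : ∀ {g : ℝ → κ}, Measurable g → indDensity F (fun x y => M (g x) (g y)) =
      ∫ q : Fin k → κ, ∏ e : Fin k × Fin k, (if e.1 < e.2 then
        (if F.Adj e.1 e.2 then M (q e.1) (q e.2) else 1 - M (q e.1) (q e.2)) else 1)
        ∂(Measure.pi fun _ => muI.map g) := by
    intro g hg
    have : IsProbabilityMeasure (muI.map g) := Measure.isProbabilityMeasure_map hg.aemeasurable
    rw [indDensity_eq, ← Measure.pi_map_pi (fun _ => hg.aemeasurable), integral_map]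
    · unfold fac
      refine integral_congr_ae (ae_of_all _ fun x => ?_)
      refine Finset.prod_congr rfl fun e _ => ?_
      congr
    · exact (measurable_pi_lambda _ fun i => hg.comp (measurable_pi_apply i)).aemeasurable
    · exact (measurable_of_finite _).aestronglyMeasurable
  rw [key m₁, key m₂, h]

open Classical in
/-- Adjacency matrix with real entries. -/
def adjR {n : ℕ} (F : SimpleGraph (Fin n)) (i j : Fin n) : ℝ := if F.Adj i j then 1 else 0

lemma adjR_symm {n : ℕ} (F : SimpleGraph (Fin n)) (i j : Fin n) : adjR F i j = adjR F j i := by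
  have h := F.adj_comm i j
  unfold adjR
  by_cases h1 : F.Adj i j
  · rw [if_pos h1, if_pos (h.1 h1)]
  · rw [if_neg h1, if_neg (fun h2 => h1 (h.2 h2))]

lemma adjR_mem {n : ℕ} (F : SimpleGraph (Fin n)) (i j : Fin n) :
    adjR F i j ∈ Set.Icc (0 : ℝ) 1 := by
  unfold adjR; split_ifs <;> simp

/-- Ordered pairs. -/
abbrev EE (n : ℕ) := {e : Fin n × Fin n // e.1 < e.2}

open Classical in
/-- Graphs as edge indicator functions. -/
def graphEquiv (n : ℕ) : SimpleGraph (Fin n) ≃ (EE n → Bool) where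
  toFun F := fun e => decide (F.Adj e.1.1 e.1.2)
  invFun b :=
    { Adj := fun i j => (∃ h : i < j, b ⟨(i, j), h⟩ = true) ∨ (∃ h : j < i, b ⟨(j, i), h⟩ = true)
      symm := ⟨fun i j h => by tauto⟩
      loopless := ⟨fun i h => by simp at h⟩ }
  left_inv F := by
    ext i j
    simp only [decide_eq_true_eq]
    constructor
    · rintro (⟨_, h⟩ | ⟨_, h⟩)
      · exact h
      · exact h.symm
    · intro h
      rcases lt_or_gt_of_ne h.ne with h' | h'
      · exact Or.inl ⟨h', h⟩
      · exact Or.inr ⟨h', h.symm⟩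
  right_inv b := by
    ext e
    obtain ⟨⟨i, j⟩, h⟩ := e
    rw [Bool.eq_iff_iff]
    refine (@decide_eq_true_iff _ (propDecidable _)).trans ?_
    constructor
    · rintro (⟨_, h⟩ | ⟨h2, h⟩)
      · exact h
      · exact absurd h2 (not_lt.2 (le_of_lt (by assumption)))
    · intro h'
      exact Or.inl ⟨h, h'⟩

open Classical in
/-- The probability of `F` given edge probabilities `P`. -/
def wgt {n : ℕ} (F : SimpleGraph (Fin n)) (P : Fin n → Fin n → ℝ) : ℝ :=
  ∏ e : EE n, if F.Adj e.1.1 e.1.2 then P e.1.1 e.1.2 else 1 - P e.1.1 e.1.2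

lemma fac_wgt {n : ℕ} (F : SimpleGraph (Fin n)) (W : ℝ → ℝ → ℝ) (x : Fin n → ℝ) :
    ∏ e, fac F W e x = wgt F (fun i j => W (x i) (x j)) := by
  classical
  unfold wgt fac
  rw [← Finset.prod_filter]
  refine Finset.prod_subtype _ (fun e => by simp) _

open Classical in
lemma wgt_sum {n : ℕ} (P c : Fin n → Fin n → ℝ) (S : Finset (EE n)) :
    ∑ F : SimpleGraph (Fin n), wgt F P * ∏ e ∈ S, (adjR F e.1.1 e.1.2 - c e.1.1 e.1.2) =
      ∏ e ∈ S, (P e.1.1 e.1.2 - c e.1.1 e.1.2) := by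
  let u : EE n → Bool → ℝ := fun e v =>
    (if v = true then P e.1.1 e.1.2 else 1 - P e.1.1 e.1.2) *
      (if e ∈ S then ((if v = true then 1 else 0) - c e.1.1 e.1.2) else 1)
  have h1 : ∀ F : SimpleGraph (Fin n), wgt F P * ∏ e ∈ S, (adjR F e.1.1 e.1.2 - c e.1.1 e.1.2) =
      ∏ e, u e (graphEquiv n F e) := by
    intro F
    rw [← Fintype.prod_ite_mem]
    unfold wgt
    rw [← Finset.prod_mul_distrib]
    refine Finset.prod_congr rfl fun e _ => ?_
    simp [u, graphEquiv, adjR]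
  simp only [h1]
  rw [Equiv.sum_comp (graphEquiv n) (fun b => ∏ e, u e (b e))]
  have h2 := Finset.prod_univ_sum (fun _ : EE n => (Finset.univ : Finset Bool)) u
  rw [Fintype.piFinset_univ] at h2
  rw [← h2, ← Fintype.prod_ite_mem S]
  refine Finset.prod_congr rfl fun e _ => ?_
  rw [Fintype.sum_bool]
  by_cases he : e ∈ S <;> simp [u, he]
  ring

lemma wgt_sum_one {n : ℕ} (P : Fin n → Fin n → ℝ) :
    ∑ F : SimpleGraph (Fin n), wgt F P = 1 := by
  simpa using wgt_sum P 0 ∅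

lemma wgt_nonneg {n : ℕ} (F : SimpleGraph (Fin n)) {P : Fin n → Fin n → ℝ}
    (hP : ∀ i j, P i j ∈ Set.Icc (0 : ℝ) 1) : 0 ≤ wgt F P := by
  refine Finset.prod_nonneg fun e _ => ?_
  have := hP e.1.1 e.1.2
  split_ifs
  · exact this.1
  · linarith [this.2]

/-- The increasing version of an unordered pair. -/
def srt {n : ℕ} {i j : Fin n} (h : i ≠ j) : EE n :=
  if h' : i < j then ⟨(i, j), h'⟩ else ⟨(j, i), lt_of_le_of_ne (not_lt.1 h') h.symm⟩

lemma srt_eval {n : ℕ} {i j : Fin n} (h : i ≠ j) (A : Fin n → Fin n → ℝ) (hA : ∀ i j, A i j = A j i) :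
    A (srt h).1.1 (srt h).1.2 = A i j := by
  unfold srt
  split_ifs
  · rfl
  · exact hA _ _

lemma srt_ne {n : ℕ} {i j k l : Fin n} (h : i ≠ j) (h' : k ≠ l)
    (H : ¬ (i = k ∧ j = l)) (H' : ¬ (i = l ∧ j = k)) : srt h ≠ srt h' := by
  unfold srt
  intro e
  split_ifs at e <;> simp only [Subtype.mk.injEq, Prod.mk.injEq] at e <;> tauto

lemma wgt_four {n : ℕ} (P c : Fin n → Fin n → ℝ) (hP : ∀ i j, P i j = P j i)
    (hc : ∀ i j, c i j = c j i) {i j k l : Fin n} (ij : i ≠ j) (ik : i ≠ k) (il : i ≠ l)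
    (jk : j ≠ k) (jl : j ≠ l) (kl : k ≠ l) :
    ∑ F : SimpleGraph (Fin n), wgt F P * ((adjR F i j - c i j) * (adjR F i l - c i l) *
      (adjR F k j - c k j) * (adjR F k l - c k l)) =
    (P i j - c i j) * (P i l - c i l) * (P k j - c k j) * (P k l - c k l) := by
  classical
  let e1 := srt ij
  let e2 := srt il
  let e3 := srt jk.symm
  let e4 := srt kl
  have h12 : e1 ≠ e2 := srt_ne _ _ (by tauto) (by tauto)
  have h13 : e1 ≠ e3 := srt_ne _ _ (by tauto) (by tauto)
  have h14 : e1 ≠ e4 := srt_ne _ _ (by tauto) (by tauto)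
  have h23 : e2 ≠ e3 := srt_ne _ _ (by tauto) (by tauto)
  have h24 : e2 ≠ e4 := srt_ne _ _ (by tauto) (by tauto)
  have h34 : e3 ≠ e4 := srt_ne _ _ (by tauto) (by tauto)
  have key := wgt_sum P c {e1, e2, e3, e4}
  have hp : ∀ A : Fin n → Fin n → ℝ, (∀ i j, A i j = A j i) →
      ∏ e ∈ ({e1, e2, e3, e4} : Finset (EE n)), A e.1.1 e.1.2 = A i j * A i l * A k j * A k l := by
    intro A hA
    rw [Finset.prod_insert (by simp [h12, h13, h14]), Finset.prod_insert (by simp [h23, h24]),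
      Finset.prod_insert (by simp [h34]), Finset.prod_singleton,
      srt_eval ij A hA, srt_eval il A hA, srt_eval jk.symm A hA, srt_eval kl A hA]
    ring
  rw [hp (fun i j => P i j - c i j) (fun i j => by rw [hP, hc])] at key
  rw [← key]
  refine Finset.sum_congr rfl fun F _ => ?_
  rw [hp (fun i j => adjR F i j - c i j) (fun i j => by rw [adjR_symm, hc])]

lemma ind_wgt {n : ℕ} (F : SimpleGraph (Fin n)) (W : ℝ → ℝ → ℝ) :
    indDensity F W = ∫ x, wgt F (fun i j => W (x i) (x j)) ∂(muP (Fin n)) := by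
  rw [indDensity_eq]; simp only [fac_wgt]

lemma wgt_meas {n : ℕ} (F : SimpleGraph (Fin n)) {W : ℝ → ℝ → ℝ} (hW : UK W) :
    Measurable (fun x : Fin n → ℝ => wgt F (fun i j => W (x i) (x j))) := by
  simp only [← fac_wgt]
  exact Finset.measurable_fun_prod _ fun e _ => fac_meas F hW e

lemma wgt_le {n : ℕ} (F : SimpleGraph (Fin n)) {W : ℝ → ℝ → ℝ} (hW : UK W) (x : Fin n → ℝ) :
    |wgt F (fun i j => W (x i) (x j))| ≤ 1 := by
  rw [← fac_wgt]
  exact prod01 _ fun e => fac_mem F hW e x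

lemma ind_nonneg {n : ℕ} (F : SimpleGraph (Fin n)) {W : ℝ → ℝ → ℝ} (hW : UK W) :
    0 ≤ indDensity F W := by
  rw [ind_wgt]
  exact integral_nonneg fun x => wgt_nonneg F fun i j => hW.2 _ _

lemma ind_sum {n : ℕ} {W : ℝ → ℝ → ℝ} (hW : UK W) :
    ∑ F : SimpleGraph (Fin n), indDensity F W = 1 := by
  simp only [ind_wgt]
  rw [← integral_finsetSum _ fun F _ => int_bdd (wgt_meas F hW) 1 (wgt_le F hW)]
  simp [wgt_sum_one]

/-- Double Cauchy–Schwarz. -/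
lemma cs4 {n : ℕ} (B : Fin n → Fin n → ℝ) (f g : Fin n → ℝ) (hf : ∀ i, |f i| ≤ 1)
    (hg : ∀ i, |g i| ≤ 1) :
    (∑ i, ∑ j, B i j * f i * g j) ^ 4 ≤ (n : ℝ) ^ 4 * ∑ j, ∑ l, (∑ i, B i j * B i l) ^ 2 := by
  set X := ∑ i, ∑ j, B i j * f i * g j with hX
  set Y := ∑ i, (∑ j, B i j * g j) ^ 2 with hY
  set Z := ∑ j, ∑ l, (∑ i, B i j * B i l) ^ 2 with hZ
  have sq1 : ∀ t : ℝ, |t| ≤ 1 → t ^ 2 ≤ 1 := fun t ht => by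
    rw [← sq_abs]; exact pow_le_one₀ (abs_nonneg _) ht
  have hY0 : 0 ≤ Y := Finset.sum_nonneg fun i _ => sq_nonneg _
  have h1 : X ^ 2 ≤ n * Y := by
    have e : X = ∑ i, f i * ∑ j, B i j * g j := by
      rw [hX]
      refine Finset.sum_congr rfl fun i _ => ?_
      rw [Finset.mul_sum]
      exact Finset.sum_congr rfl fun j _ => by ring
    rw [e]
    refine (Finset.sum_mul_sq_le_sq_mul_sq _ _ _).trans ?_
    refine mul_le_mul_of_nonneg_right ?_ hY0
    calc ∑ i, f i ^ 2 ≤ ∑ i : Fin n, (1 : ℝ) := Finset.sum_le_sum fun i _ => sq1 _ (hf i)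
      _ = n := by simp
  have h2 : Y ^ 2 ≤ (n : ℝ) ^ 2 * Z := by
    have e : Y = ∑ q : Fin n × Fin n, (g q.1 * g q.2) * (∑ i, B i q.1 * B i q.2) := by
      rw [hY, Fintype.sum_prod_type]
      have : ∀ i, (∑ j, B i j * g j) ^ 2 = ∑ j, ∑ l, (B i j * g j) * (B i l * g l) := by
        intro i; rw [pow_two, Finset.sum_mul_sum]
      simp only [this]
      rw [Finset.sum_comm]
      refine Finset.sum_congr rfl fun j _ => ?_
      rw [Finset.sum_comm]
      refine Finset.sum_congr rfl fun l _ => ?_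
      rw [Finset.mul_sum]
      exact Finset.sum_congr rfl fun i _ => by ring
    rw [e]
    refine (Finset.sum_mul_sq_le_sq_mul_sq _ _ _).trans ?_
    have hZ' : Z = ∑ q : Fin n × Fin n, (∑ i, B i q.1 * B i q.2) ^ 2 := by
      rw [hZ, Fintype.sum_prod_type]
    rw [← hZ']
    refine mul_le_mul_of_nonneg_right ?_ ?_
    · calc ∑ q : Fin n × Fin n, (g q.1 * g q.2) ^ 2 ≤ ∑ q : Fin n × Fin n, (1 : ℝ) :=
          Finset.sum_le_sum fun q _ => sq1 _ (by
            rw [abs_mul]; exact mul_le_one₀ (hg _) (abs_nonneg _) (hg _))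
        _ = (n : ℝ) ^ 2 := by simp [pow_two]
    · rw [hZ']; exact Finset.sum_nonneg fun i _ => sq_nonneg _
  have h3 : (X ^ 2) ^ 2 ≤ (n * Y) ^ 2 := pow_le_pow_left₀ (sq_nonneg _) h1 2
  nlinarith [mul_le_mul_of_nonneg_left h2 (sq_nonneg (n : ℝ))]

lemma cs4_expand {n : ℕ} (B : Fin n → Fin n → ℝ) :
    ∑ j, ∑ l, (∑ i, B i j * B i l) ^ 2 =
      ∑ j, ∑ l, ∑ i, ∑ k, B i j * B i l * B k j * B k l := by
  refine Finset.sum_congr rfl fun j _ => Finset.sum_congr rfl fun l _ => ?_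
  rw [pow_two, Finset.sum_mul_sum]
  exact Finset.sum_congr rfl fun i _ => Finset.sum_congr rfl fun k _ => by ring

lemma ker_meas {ι : Type} {D : ℝ → ℝ → ℝ} (hD : Measurable (Function.uncurry D)) (i j : ι) :
    Measurable (fun x : ι → ℝ => D (x i) (x j)) :=
  hD.comp (f := fun x : ι → ℝ => (x i, x j)) ((measurable_pi_apply i).prodMk (measurable_pi_apply j))

lemma four_int {n : ℕ} {D : ℝ → ℝ → ℝ} {δ : ℝ} (hm : BK D) (hD : ∀ x y, |D x y| ≤ 1)
    (h : Reg D δ) {i j k l : Fin n} (ij : i ≠ j) (ik : i ≠ k) (il : i ≠ l)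
    (jl : j ≠ l) :
    |∫ x, D (x i) (x j) * D (x i) (x l) * D (x k) (x j) * D (x k) (x l) ∂(muP (Fin n))| ≤ δ := by
  have := pair_bound (ι := Fin n) ij hm h (f := fun x => D (x i) (x l))
    (g := fun x => D (x k) (x j) * D (x k) (x l)) (ker_meas hm.1 i l)
    ((ker_meas hm.1 k j).mul (ker_meas hm.1 k l)) (fun x => hD _ _)
    (fun x => by rw [abs_mul]; exact mul_le_one₀ (hD _ _) (abs_nonneg _) (hD _ _))
    (fun x u => by simp [Function.update_of_ne ij, Function.update_of_ne jl.symm])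
    (fun x u => by simp [Function.update_of_ne ik.symm, Function.update_of_ne ij.symm,
      Function.update_of_ne il.symm])
  convert this using 3
  ext x; ring

/-- Deviation of the adjacency matrix from the step kernel. -/
def devB {n K : ℕ} (F : SimpleGraph (Fin n)) (a : ℝ → Fin K) (M : Fin K → Fin K → ℝ)
    (x : Fin n → ℝ) (i j : Fin n) : ℝ := adjR F i j - M (a (x i)) (a (x j))

lemma abs_sub_unit {u v : ℝ} (hu : u ∈ Set.Icc (0 : ℝ) 1) (hv : v ∈ Set.Icc (0 : ℝ) 1) :
    |u - v| ≤ 1 := by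
  rw [abs_le]; constructor <;> linarith [hu.1, hu.2, hv.1, hv.2]

lemma devB_le {n K : ℕ} (F : SimpleGraph (Fin n)) (a : ℝ → Fin K) {M : Fin K → Fin K → ℝ}
    (hM : SM M) (x : Fin n → ℝ) (i j : Fin n) : |devB F a M x i j| ≤ 1 :=
  abs_sub_unit (adjR_mem F i j) (hM.2 _ _)

lemma devB_meas {n K : ℕ} (F : SimpleGraph (Fin n)) {a : ℝ → Fin K} (ha : Measurable a)
    (M : Fin K → Fin K → ℝ) (i j : Fin n) : Measurable (fun x => devB F a M x i j) :=
  measurable_const.sub (ker_meas (D := fun x y => M (a x) (a y)) (BK.step ha M).1 i j)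

lemma abs4 {a b c d : ℝ} (ha : |a| ≤ 1) (hb : |b| ≤ 1) (hc : |c| ≤ 1) (hd : |d| ≤ 1) :
    |a * b * c * d| ≤ 1 := by
  rw [abs_mul, abs_mul, abs_mul]
  exact mul_le_one₀ (mul_le_one₀ (mul_le_one₀ ha (abs_nonneg _) hb) (abs_nonneg _) hc)
    (abs_nonneg _) hd

lemma c4_exp {n K : ℕ} {W : ℝ → ℝ → ℝ} (hW : IsGraphon W) {a : ℝ → Fin K} (ha : Measurable a)
    {M : Fin K → Fin K → ℝ} (hM : SM M) {δ : ℝ}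
    (h : Reg (fun x y => W x y - M (a x) (a y)) δ) :
    ∫ x, ∑ F : SimpleGraph (Fin n), wgt F (fun i j => W (x i) (x j)) *
      (∑ j, ∑ l, (∑ i, devB F a M x i j * devB F a M x i l) ^ 2) ∂(muP (Fin n))
      ≤ (n : ℝ) ^ 4 * δ + 6 * (n : ℝ) ^ 3 := by
  classical
  let T : Fin n × Fin n × Fin n × Fin n → (Fin n → ℝ) → ℝ := fun q x =>
    ∑ F : SimpleGraph (Fin n), wgt F (fun i j => W (x i) (x j)) *
      (devB F a M x q.2.2.1 q.1 * devB F a M x q.2.2.1 q.2.1 *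
       devB F a M x q.2.2.2 q.1 * devB F a M x q.2.2.2 q.2.1)
  have e1 : ∀ x : Fin n → ℝ, ∑ F : SimpleGraph (Fin n), wgt F (fun i j => W (x i) (x j)) *
      (∑ j, ∑ l, (∑ i, devB F a M x i j * devB F a M x i l) ^ 2) = ∑ q, T q x := by
    intro x
    simp only [T]
    rw [Finset.sum_comm]
    refine Finset.sum_congr rfl fun F _ => ?_
    rw [cs4_expand, ← Finset.mul_sum]
    simp only [Fintype.sum_prod_type]
  have hw1 := fun x : Fin n → ℝ => wgt_sum_one (fun i j => W (x i) (x j))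
  have hTm : ∀ q, Measurable (T q) := fun q =>
    Finset.measurable_fun_sum _ fun F _ => (wgt_meas F hW.uk).mul
      ((((devB_meas F ha M _ _).mul (devB_meas F ha M _ _)).mul (devB_meas F ha M _ _)).mul
        (devB_meas F ha M _ _))
  have hTb : ∀ q x, |T q x| ≤ 1 := by
    intro q x
    rw [← hw1 x]
    refine (Finset.abs_sum_le_sum_abs _ _).trans (Finset.sum_le_sum fun F _ => ?_)
    have hw := wgt_nonneg F (P := fun i j => W (x i) (x j)) fun i j => hW.2.2 _ _
    rw [abs_mul, abs_of_nonneg hw]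
    exact mul_le_of_le_one_right hw (abs4 (devB_le F a hM x _ _) (devB_le F a hM x _ _)
      (devB_le F a hM x _ _) (devB_le F a hM x _ _))
  simp only [e1]
  rw [integral_finsetSum _ fun q _ => int_bdd (hTm q) 1 (hTb q)]
  let ind : Fin n → Fin n → ℝ := fun i j => if i = j then 1 else 0
  have ind0 : ∀ i j, 0 ≤ ind i j := fun i j => by simp only [ind]; split_ifs <;> simp
  have hδ := h.nonneg
  have hq : ∀ q : Fin n × Fin n × Fin n × Fin n, ∫ x, T q x ∂(muP (Fin n)) ≤
      δ + (ind q.1 q.2.1 + ind q.1 q.2.2.1 + ind q.1 q.2.2.2 + ind q.2.1 q.2.2.1 + ind q.2.1 q.2.2.2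
        + ind q.2.2.1 q.2.2.2) := by
    rintro ⟨j, l, i, k⟩
    simp only
    have hle : ∫ x, T (j, l, i, k) x ∂(muP (Fin n)) ≤ 1 :=
      (le_abs_self _).trans (abs_int_le 1 (hTb _))
    have := ind0 j l
    have := ind0 j i
    have := ind0 j k
    have := ind0 l i
    have := ind0 l k
    have := ind0 i k
    have i1 : ∀ u : Fin n, ind u u = 1 := fun u => by simp [ind]
    by_cases jl : j = l
    · subst jl; have := i1 j; linarith
    by_cases ji : j = i
    · subst ji; have := i1 j; linarith
    by_cases jk : j = k
    · subst jk; have := i1 j; linarith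
    by_cases li : l = i
    · subst li; have := i1 l; linarith
    by_cases lk : l = k
    · subst lk; have := i1 l; linarith
    by_cases ik : i = k
    · subst ik; have := i1 i; linarith
    have eT : ∀ x, T (j, l, i, k) x = (W (x i) (x j) - M (a (x i)) (a (x j))) *
        (W (x i) (x l) - M (a (x i)) (a (x l))) * (W (x k) (x j) - M (a (x k)) (a (x j))) *
        (W (x k) (x l) - M (a (x k)) (a (x l))) := fun x =>
      wgt_four (fun i j => W (x i) (x j)) (fun i j => M (a (x i)) (a (x j)))
        (fun i j => hW.2.1 _ _) (fun i j => hM.1 _ _) (Ne.symm ji) ik (Ne.symm li) jk jl (Ne.symm (Ne.symm lk)).symm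
    have b := four_int (n := n) (D := fun x y => W x y - M (a x) (a y))
      ((BK.graphon hW).sub (BK.step ha M)) (fun x y => abs_sub_unit (hW.2.2 _ _) (hM.2 _ _)) h
      (Ne.symm ji) ik (Ne.symm li) jl
    have : ∫ x, T (j, l, i, k) x ∂(muP (Fin n)) ≤ δ := by
      simp only [eT]
      exact (le_abs_self _).trans b
    linarith
  refine (Finset.sum_le_sum fun q _ => hq q).trans ?_
  rw [Finset.sum_add_distrib]
  refine add_le_add (by simp; apply le_of_eq; ring) ?_
  have hr : ∀ i, ∑ j, ind i j = 1 := fun i => by simp [ind]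
  clear_value ind
  simp only [Finset.sum_add_distrib, Fintype.sum_prod_type, Finset.sum_const, Finset.card_univ,
    Fintype.card_fin, Fintype.card_prod, Nat.cast_mul, nsmul_eq_mul, ← Finset.mul_sum, hr, mul_one]
  apply le_of_eq; ring

lemma var_exp {n : ℕ} {A : Set ℝ} (hA : MeasurableSet A) :
    ∫ x : Fin n → ℝ, (∑ i, (A.indicator (fun _ => (1 : ℝ)) (x i) - muI.real A)) ^ 2 ∂(muP (Fin n))
      ≤ n := by
  classical
  let ξ : ℝ → ℝ := fun u => A.indicator (fun _ => (1 : ℝ)) u - muI.real A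
  have hξm : Measurable ξ := (measurable_const.indicator hA).sub measurable_const
  have h01 : ∀ u, A.indicator (fun _ => (1 : ℝ)) u ∈ Set.Icc (0 : ℝ) 1 := fun u => by
    by_cases h : u ∈ A <;> simp [h]
  have hξb : ∀ u, |ξ u| ≤ 1 := fun u => abs_sub_unit (h01 u) ⟨measureReal_nonneg, measureReal_le_one⟩
  have hξ0 : ∫ u, ξ u ∂muI = 0 := by
    simp only [ξ]
    rw [integral_sub, integral_indicator_const _ hA]
    · simp
    · exact int_bdd (measurable_const.indicator hA) 1 fun u => by
        rw [abs_of_nonneg (h01 u).1]; exact (h01 u).2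
    · exact integrable_const _
  have hm : ∀ q : Fin n × Fin n, Measurable (fun x : Fin n → ℝ => ξ (x q.1) * ξ (x q.2)) := fun q =>
    (hξm.comp (measurable_pi_apply _)).mul (hξm.comp (measurable_pi_apply _))
  have hb : ∀ (q : Fin n × Fin n) (x : Fin n → ℝ), |ξ (x q.1) * ξ (x q.2)| ≤ 1 := fun q x => by
    rw [abs_mul]; exact mul_le_one₀ (hξb _) (abs_nonneg _) (hξb _)
  have e : ∀ x : Fin n → ℝ, (∑ i, (A.indicator (fun _ => (1 : ℝ)) (x i) - muI.real A)) ^ 2 =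
      ∑ q : Fin n × Fin n, ξ (x q.1) * ξ (x q.2) := by
    intro x
    rw [pow_two, Finset.sum_mul_sum, Fintype.sum_prod_type]
  simp only [e]
  rw [integral_finsetSum _ fun q _ => int_bdd (hm q) 1 (hb q)]
  have hq : ∀ q : Fin n × Fin n, ∫ x : Fin n → ℝ, ξ (x q.1) * ξ (x q.2) ∂(muP (Fin n)) ≤
      if q.1 = q.2 then 1 else 0 := by
    intro q
    split_ifs with hq
    · exact (le_abs_self _).trans (abs_int_le 1 (hb q))
    · rw [resample q.1 (hm q) 1 (hb q)]
      simp only [Function.update_self, Function.update_of_ne (Ne.symm hq)]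
      simp [integral_mul_const, hξ0]
  refine (Finset.sum_le_sum fun q _ => hq q).trans ?_
  rw [Fintype.sum_prod_type]
  simp

open Classical in
lemma markov_graph {n : ℕ} {W : ℝ → ℝ → ℝ} (hW : UK W) (Bad : SimpleGraph (Fin n) → Prop)
    (Φ : SimpleGraph (Fin n) → (Fin n → ℝ) → ℝ) (hm : ∀ F, Measurable (Φ F)) (C : ℝ)
    (hC : ∀ F x, |Φ F x| ≤ C) (h0 : ∀ F x, 0 ≤ Φ F x) (h1 : ∀ F, Bad F → ∀ x, 1 ≤ Φ F x) :
    ∑ F, (if Bad F then indDensity F W else 0) ≤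
      ∫ x, ∑ F, wgt F (fun i j => W (x i) (x j)) * Φ F x ∂(muP (Fin n)) := by
  have hint : ∀ F, Integrable (fun x => wgt F (fun i j => W (x i) (x j)) * Φ F x) (muP (Fin n)) :=
    fun F => int_bdd ((wgt_meas F hW).mul (hm F)) C fun x => by
      rw [abs_mul]
      have := mul_le_mul (wgt_le F hW x) (hC F x) (abs_nonneg _) zero_le_one
      simpa using this
  rw [integral_finsetSum _ fun F _ => hint F]
  refine Finset.sum_le_sum fun F _ => ?_
  have hw := fun x : Fin n → ℝ => wgt_nonneg F (P := fun i j => W (x i) (x j)) fun i j => hW.2 _ _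
  split_ifs with hF
  · rw [ind_wgt]
    refine integral_mono (int_bdd (wgt_meas F hW) 1 (wgt_le F hW)) (hint F) fun x => ?_
    exact le_mul_of_one_le_right (hw x) (h1 F hF x)
  · exact integral_nonneg fun x => mul_nonneg (hw x) (h0 F x)

/-- Coupling of an empirical distribution with a given distribution. -/
lemma coupling {κ : Type} [Fintype κ] [DecidableEq κ] {n : ℕ} (hn : 0 < n) (α : Fin n → κ) (q : κ → ℝ)
    (hq : ∀ c, 0 ≤ q c) (hq1 : ∑ c, q c = 1) :
    ∃ p : κ → Fin n → ℝ, (∀ c i, 0 ≤ p c i) ∧ (∀ c, ∑ i, p c i = q c) ∧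
      (∀ i, ∑ c, p c i = 1 / n) ∧
      ∑ c, ∑ i, (if α i = c then 0 else p c i) ≤
        ∑ c, |q c - (∑ i, if α i = c then (1 : ℝ) else 0) / n| := by
  have hn' : (0 : ℝ) < n := by exact_mod_cast hn
  let N : κ → ℝ := fun c => ∑ i, if α i = c then (1 : ℝ) else 0
  let r : κ → ℝ := fun c => N c / n
  have hN0 : ∀ c, 0 ≤ N c := fun c => Finset.sum_nonneg fun i _ => by split_ifs <;> simp
  have hr0 : ∀ c, 0 ≤ r c := fun c => div_nonneg (hN0 c) hn'.le
  let m : κ → ℝ := fun c => min (q c) (r c)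
  have hm0 : ∀ c, 0 ≤ m c := fun c => le_min (hq c) (hr0 c)
  let v : κ → ℝ := fun c => m c / N c
  have hv0 : ∀ c, 0 ≤ v c := fun c => div_nonneg (hm0 c) (hN0 c)
  have hvN : ∀ c, N c * v c = m c := by
    intro c
    by_cases h : N c = 0
    · have : m c = 0 := le_antisymm ((min_le_right _ _).trans (by simp [r, h])) (hm0 c)
      simp [h, this]
    · simp only [v]; field_simp
  have hvn : ∀ c, v c ≤ 1 / n := by
    intro c
    by_cases h : N c = 0
    · simp only [v, h, div_zero]; positivity
    · have hp : 0 < N c := lt_of_le_of_ne (hN0 c) (Ne.symm h)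
      simp only [v]
      rw [div_le_iff₀ hp]
      refine (min_le_right _ _).trans ?_
      simp only [r]; apply le_of_eq; ring
  let d : κ → ℝ := fun c => q c - m c
  have hd0 : ∀ c, 0 ≤ d c := fun c => sub_nonneg.2 (min_le_left _ _)
  let e : Fin n → ℝ := fun i => 1 / n - v (α i)
  have he0 : ∀ i, 0 ≤ e i := fun i => sub_nonneg.2 (hvn _)
  let τ : ℝ := ∑ c, d c
  have hτ0 : 0 ≤ τ := Finset.sum_nonneg fun c _ => hd0 c
  have hsumv : ∑ i, v (α i) = ∑ c, m c := by
    have : ∀ c, m c = ∑ i, if α i = c then v c else 0 := by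
      intro c
      rw [← hvN c, Finset.sum_mul]
      exact Finset.sum_congr rfl fun i _ => by split_ifs <;> simp
    simp only [this]
    rw [Finset.sum_comm]
    simp
  have heτ : ∑ i, e i = τ := by
    simp only [e, τ, d, Finset.sum_sub_distrib, hsumv, hq1]
    simp [hn'.ne']
  have hdτ : ∀ c, d c * τ / τ = d c := by
    intro c
    by_cases h : τ = 0
    · have : d c = 0 := (Finset.sum_eq_zero_iff_of_nonneg fun c _ => hd0 c).1 h c (Finset.mem_univ c)
      simp [this]
    · field_simp
  have heτ' : ∀ i, τ * e i / τ = e i := by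
    intro i
    by_cases h : τ = 0
    · have : e i = 0 := (Finset.sum_eq_zero_iff_of_nonneg fun i _ => he0 i).1 (heτ.trans h) i
        (Finset.mem_univ i)
      simp [this]
    · field_simp
  refine ⟨fun c i => (if α i = c then v c else 0) + d c * e i / τ, ?_, ?_, ?_, ?_⟩
  · intro c i
    have : 0 ≤ d c * e i / τ := div_nonneg (mul_nonneg (hd0 c) (he0 i)) hτ0
    dsimp only
    split_ifs
    · linarith [hv0 c]
    · linarith
  · intro c
    rw [Finset.sum_add_distrib, ← Finset.sum_div, ← Finset.mul_sum, heτ, hdτ]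
    have : ∑ i, (if α i = c then v c else 0) = m c := by
      rw [← hvN c, Finset.sum_mul]
      exact Finset.sum_congr rfl fun i _ => by split_ifs <;> simp
    rw [this]; simp [d]
  · intro i
    rw [Finset.sum_add_distrib, ← Finset.sum_div, ← Finset.sum_mul]
    rw [show (∑ c, d c) = τ from rfl, heτ']
    simp [e]
  · calc ∑ c, ∑ i, (if α i = c then 0 else (if α i = c then v c else 0) + d c * e i / τ)
        ≤ ∑ c, ∑ i, d c * e i / τ := by
          refine Finset.sum_le_sum fun c _ => Finset.sum_le_sum fun i _ => ?_
          have : 0 ≤ d c * e i / τ := div_nonneg (mul_nonneg (hd0 c) (he0 i)) hτ0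
          split_ifs
          · exact this
          · simp
      _ = ∑ c, d c := by
          refine Finset.sum_congr rfl fun c _ => ?_
          rw [← Finset.sum_div, ← Finset.mul_sum, heτ, hdτ]
      _ ≤ _ := by
          refine Finset.sum_le_sum fun c _ => ?_
          change q c - min (q c) (r c) ≤ |q c - r c|
          rcases min_choice (q c) (r c) with h | h <;> rw [h]
          · simp
          · exact le_abs_self _

/-- `F` is a good finite approximation of `W`. -/
def Close {n : ℕ} (W : ℝ → ℝ → ℝ) (F : SimpleGraph (Fin n)) (ε : ℝ) : Prop :=
  ∃ s : ℝ → Fin n, Measurable s ∧ (∀ i, muI.real (s ⁻¹' {i}) = 1 / n) ∧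
    Reg (fun x y => W x y - adjR F (s x) (s y)) ε

lemma Close.iso {n : ℕ} {W : ℝ → ℝ → ℝ} {G H : SimpleGraph (Fin n)} {ε : ℝ} (h : Close W G ε)
    (φ : G ≃g H) : Close W H ε := by
  obtain ⟨s, hs, hu, hr⟩ := h
  refine ⟨fun x => φ (s x), (measurable_of_finite (fun i => φ i)).comp hs, fun i => ?_, ?_⟩
  · have : (fun x => φ (s x)) ⁻¹' {i} = s ⁻¹' {φ.symm i} := by
      ext x
      simp only [Set.mem_preimage, Set.mem_singleton_iff]
      constructor
      · rintro rfl; simp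
      · intro h; rw [h]; simp
    rw [this, hu]
  · convert hr using 4 with x y
    have h := φ.map_adj_iff (v := s x) (w := s y)
    unfold adjR
    by_cases h1 : G.Adj (s x) (s y)
    · rw [if_pos h1, if_pos (h.2 h1)]
    · rw [if_neg h1, if_neg (fun h2 => h1 (h.1 h2))]

open Classical in
lemma step_reg {n : ℕ} (hn : 0 < n) {s : ℝ → Fin n} (hs : Measurable s)
    (hu : ∀ i, muI.real (s ⁻¹' {i}) = 1 / n) {B : Fin n → Fin n → ℝ} {η : ℝ} (hη : 0 ≤ η)
    (hB : ∑ j, ∑ l, (∑ i, B i j * B i l) ^ 2 ≤ (n : ℝ) ^ 4 * η ^ 4) :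
    Reg (fun x y => B (s x) (s y)) η := by
  intro f g hf hg hf1 hg1
  have hn' : (0 : ℝ) < n := by exact_mod_cast hn
  let χ : (ℝ → ℝ) → Fin n → ℝ → ℝ := fun f i => (s ⁻¹' {i}).indicator f
  have hχm : ∀ {f : ℝ → ℝ}, Measurable f → ∀ i, Measurable (χ f i) := fun hf i =>
    hf.indicator (hs (measurableSet_singleton i))
  have hχb : ∀ {f : ℝ → ℝ}, (∀ x, |f x| ≤ 1) → ∀ i x, |χ f i x| ≤ 1 := by
    intro f hf i x
    by_cases h : x ∈ s ⁻¹' {i}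
    · simp only [χ, Set.indicator_of_mem h]; exact hf x
    · simp [χ, Set.indicator_of_notMem h]
  have hub : ∀ {f : ℝ → ℝ}, Measurable f → (∀ x, |f x| ≤ 1) → ∀ i, |(n : ℝ) * ∫ x, χ f i x ∂muI| ≤ 1 := by
    intro f hfm hf i
    have h1 : |∫ x, χ f i x ∂muI| ≤ ∫ x, (s ⁻¹' {i}).indicator (fun _ => (1 : ℝ)) x ∂muI := by
      refine abs_integral_le_integral_abs.trans (integral_mono
        (int_bdd (hχm hfm i) 1 (hχb hf i)).abs ?_ fun x => ?_)
      · exact (integrable_const _).indicator (hs (measurableSet_singleton i))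
      · by_cases h : x ∈ s ⁻¹' {i}
        · simp only [χ, Set.indicator_of_mem h]; exact hf x
        · simp [χ, Set.indicator_of_notMem h]
    rw [integral_indicator_const _ (hs (measurableSet_singleton i)), hu] at h1
    rw [abs_mul, abs_of_pos hn']
    calc (n : ℝ) * |∫ x, χ f i x ∂muI| ≤ n * (1 / n * 1) := by
          refine mul_le_mul_of_nonneg_left ?_ hn'.le
          simpa using h1
      _ = 1 := by field_simp
  have key := cs4 B (fun i => n * ∫ x, χ f i x ∂muI) (fun i => n * ∫ x, χ g i x ∂muI)
    (hub hf hf1) (hub hg hg1)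
  have e : ∫ p, B (s p.1) (s p.2) * f p.1 * g p.2 ∂(muI.prod muI) =
      ∑ i, ∑ j, B i j * ((∫ x, χ f i x ∂muI) * ∫ x, χ g j x ∂muI) := by
    have e1 : ∀ p : ℝ × ℝ, B (s p.1) (s p.2) * f p.1 * g p.2 =
        ∑ q : Fin n × Fin n, B q.1 q.2 * (χ f q.1 p.1 * χ g q.2 p.2) := by
      intro p
      rw [Finset.sum_eq_single (s p.1, s p.2)]
      · simp [χ]; ring
      · intro q _ hq
        by_cases h1 : p.1 ∈ s ⁻¹' {q.1}
        · by_cases h2 : p.2 ∈ s ⁻¹' {q.2}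
          · exact absurd (Prod.ext h1.symm h2.symm) hq
          · simp [χ, Set.indicator_of_notMem h2]
        · simp [χ, Set.indicator_of_notMem h1]
      · simp
    simp only [e1]
    rw [integral_finsetSum, Fintype.sum_prod_type]
    · refine Finset.sum_congr rfl fun i _ => Finset.sum_congr rfl fun j _ => ?_
      rw [integral_const_mul, integral_prod_mul]
    · intro q _
      refine Integrable.const_mul ?_ _
      exact Integrable.mul_prod (int_bdd (hχm hf _) 1 (hχb hf1 _)) (int_bdd (hχm hg _) 1 (hχb hg1 _))
  rw [e]
  set X := ∑ i, ∑ j, B i j * ((∫ x, χ f i x ∂muI) * ∫ x, χ g j x ∂muI) with hX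
  have e2 : ∑ i, ∑ j, B i j * (n * ∫ x, χ f i x ∂muI) * (n * ∫ x, χ g j x ∂muI) = n ^ 2 * X := by
    rw [hX, Finset.mul_sum]
    refine Finset.sum_congr rfl fun i _ => ?_
    rw [Finset.mul_sum]
    exact Finset.sum_congr rfl fun j _ => by ring
  rw [e2] at key
  have h4 : X ^ 4 ≤ η ^ 4 := by
    have h5 : (n : ℝ) ^ 8 * X ^ 4 ≤ (n : ℝ) ^ 8 * η ^ 4 := by
      calc (n : ℝ) ^ 8 * X ^ 4 = (n ^ 2 * X) ^ 4 := by ring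
        _ ≤ _ := key
        _ ≤ (n : ℝ) ^ 4 * ((n : ℝ) ^ 4 * η ^ 4) := mul_le_mul_of_nonneg_left hB (by positivity)
        _ = _ := by ring
    exact le_of_mul_le_mul_left h5 (by positivity)
  have h6 : |X| ^ 4 ≤ η ^ 4 := by
    have : |X| ^ 4 = X ^ 4 := by
      rw [show (4 : ℕ) = 2 * 2 from rfl, pow_mul, pow_mul, sq_abs]
    rw [this]; exact h4
  exact le_of_pow_le_pow_left₀ (by norm_num) hη h6

lemma couple_reg {K : ℕ} {a b : ℝ → Fin K} (ha : Measurable a) (hb : Measurable b)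
    {M : Fin K → Fin K → ℝ} (hM : SM M) {τ : ℝ} (h : muI.real {x | a x ≠ b x} ≤ τ) :
    Reg (fun x y => M (a x) (a y) - M (b x) (b y)) (2 * τ) := by
  refine Reg.of_l1 ((BK.step ha M).sub (BK.step hb M)) ?_
  have hS : MeasurableSet {x | a x ≠ b x} := (measurableSet_eq_fun ha hb).compl
  let χ : ℝ → ℝ := {x | a x ≠ b x}.indicator fun _ => 1
  have hχm : Measurable χ := measurable_const.indicator hS
  have h01 : ∀ u, χ u ∈ Set.Icc (0 : ℝ) 1 := fun u => by
    by_cases h : u ∈ {x | a x ≠ b x}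
    · simp only [χ, Set.indicator_of_mem h]; simp
    · simp only [χ, Set.indicator_of_notMem h]; simp
  have hχb : ∀ u, |χ u| ≤ 1 := fun u => by rw [abs_of_nonneg (h01 u).1]; exact (h01 u).2
  have hi : ∫ u, χ u ∂muI ≤ τ := by
    simp only [χ]; rw [integral_indicator_const _ hS]; simpa using h
  calc ∫ p, |M (a p.1) (a p.2) - M (b p.1) (b p.2)| ∂(muI.prod muI)
      ≤ ∫ p, (χ p.1 + χ p.2) ∂(muI.prod muI) := by
        refine integral_mono ((BK.step ha M).sub (BK.step hb M)).abs.integrable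
          ((BK.fst hχm hχb).add (BK.snd hχm hχb)).integrable fun p => ?_
        have h1 := h01 p.1
        have h2 := h01 p.2
        have hle := abs_sub_unit (hM.2 (a p.1) (a p.2)) (hM.2 (b p.1) (b p.2))
        by_cases e1 : a p.1 = b p.1
        · by_cases e2 : a p.2 = b p.2
          · simp only [e1, e2, sub_self, abs_zero]; linarith [h1.1, h2.1]
          · have : χ p.2 = 1 := by simp [χ, e2]
            simp only; linarith [h1.1]
        · have : χ p.1 = 1 := by simp [χ, e1]
          simp only; linarith [h2.1]
    _ = ∫ u, χ u ∂muI + ∫ u, χ u ∂muI := by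
        rw [integral_add (BK.fst hχm hχb).integrable (BK.snd hχm hχb).integrable]
        rw [integral_fun_fst, integral_fun_snd]; simp
    _ ≤ 2 * τ := by linarith

open Classical in
lemma close_of_good {n K : ℕ} (hn : 0 < n) {W : ℝ → ℝ → ℝ} (hW : IsGraphon W)
    {a : ℝ → Fin K} (ha : Measurable a)
    {M : Fin K → Fin K → ℝ} (hM : SM M) {δ η τ : ℝ} (hη : 0 ≤ η)
    (h : Reg (fun x y => W x y - M (a x) (a y)) δ) (F : SimpleGraph (Fin n)) (x : Fin n → ℝ)
    (h4 : ∑ j, ∑ l, (∑ i, devB F a M x i j * devB F a M x i l) ^ 2 ≤ (n : ℝ) ^ 4 * η ^ 4)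
    (hτ : ∀ c, |∑ i, ((a ⁻¹' {c}).indicator (fun _ => (1 : ℝ)) (x i) - muI.real (a ⁻¹' {c}))| ≤ n * τ) :
    Close W F (δ + (2 * (K * τ) + η)) := by
  have hn' : (0 : ℝ) < n := by exact_mod_cast hn
  have : Nonempty (Fin n) := ⟨⟨0, hn⟩⟩
  obtain ⟨p, hp0, hpr, hpc, hpo⟩ := coupling hn (fun i => a (x i)) (fun c => muI.real (a ⁻¹' {c}))
    (fun c => measureReal_nonneg) (by
      have := sum_real_fiber ha MeasurableSet.univ
      simpa using this)
  obtain ⟨s, hs, hsp⟩ := split2 ha p hp0 hpr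
  have hu : ∀ i, muI.real (s ⁻¹' {i}) = 1 / n := by
    intro i
    rw [← hpc i, ← sum_real_fiber ha (hs (measurableSet_singleton i))]
    exact Finset.sum_congr rfl fun c _ => by rw [Set.inter_comm, hsp]
  have hb : Measurable (fun z => a (x (s z))) := (measurable_of_finite (fun i => a (x i))).comp hs
  refine ⟨s, hs, hu, ?_⟩
  have hdis : muI.real {z | a z ≠ a (x (s z))} ≤ K * τ := by
    have hsub : {z | a z ≠ a (x (s z))} ⊆ ⋃ q : Fin K × Fin n,
        (if a (x q.2) = q.1 then ∅ else a ⁻¹' {q.1} ∩ s ⁻¹' {q.2}) := by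
      intro z hz
      refine Set.mem_iUnion.2 ⟨(a z, s z), ?_⟩
      rw [if_neg (fun h => hz h.symm)]
      exact ⟨rfl, rfl⟩
    refine (measureReal_mono hsub).trans ((measureReal_iUnion_fintype_le _).trans ?_)
    have e : ∀ q : Fin K × Fin n, muI.real (if a (x q.2) = q.1 then ∅ else a ⁻¹' {q.1} ∩ s ⁻¹' {q.2})
        = if a (x q.2) = q.1 then 0 else p q.1 q.2 := by
      intro q
      split_ifs
      · simp
      · exact hsp _ _
    simp only [e]
    rw [Fintype.sum_prod_type]
    refine hpo.trans ?_
    calc ∑ c, |muI.real (a ⁻¹' {c}) - (∑ i, if a (x i) = c then (1 : ℝ) else 0) / n|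
        ≤ ∑ c : Fin K, τ := by
          refine Finset.sum_le_sum fun c _ => ?_
          have h1 := hτ c
          rw [Finset.sum_sub_distrib] at h1
          have e2 : ∑ i, (a ⁻¹' {c}).indicator (fun _ => (1 : ℝ)) (x i) =
              ∑ i, if a (x i) = c then (1 : ℝ) else 0 := by
            refine Finset.sum_congr rfl fun i _ => ?_
            simp [Set.indicator_apply]
          rw [e2] at h1
          simp only [Finset.sum_const, Finset.card_univ, Fintype.card_fin, nsmul_eq_mul] at h1
          set N := ∑ i, if a (x i) = c then (1 : ℝ) else 0
          have e3 : muI.real (a ⁻¹' {c}) - N / n = - ((N - n * muI.real (a ⁻¹' {c})) / n) := by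
            field_simp; ring
          rw [e3, abs_neg, abs_div, abs_of_pos hn', div_le_iff₀ hn']
          linarith
      _ = K * τ := by simp
  have r2 := couple_reg ha hb hM hdis
  have r3 : Reg (fun y z => M (a (x (s y))) (a (x (s z))) - adjR F (s y) (s z)) η := by
    have := (step_reg hn hs hu hη h4).neg
    simpa [devB] using this
  have bF : BK (fun y z => adjR F (s y) (s z)) := BK.step hs _
  exact h.tri (BK.graphon hW) (BK.step ha M) bF (r2.tri (BK.step ha M) (BK.step hb M) bF r3)

lemma Close.mono {n : ℕ} {W : ℝ → ℝ → ℝ} {F : SimpleGraph (Fin n)} {ε ε' : ℝ} (h : Close W F ε)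
    (hle : ε ≤ ε') : Close W F ε' := by
  obtain ⟨s, hs, hu, hr⟩ := h
  exact ⟨s, hs, hu, hr.mono hle⟩

lemma graphon_one : IsGraphon (fun _ _ => 1) := ⟨measurable_const, fun _ _ => rfl, by simp⟩

open Classical in
/-- A large sample of `W` approximates `W`. -/
theorem sampling (ε : ℝ) (hε : 0 < ε) : ∃ n₀ : ℕ, 1 ≤ n₀ ∧ ∀ n, n₀ ≤ n → ∀ W, IsGraphon W →
    ∑ F : SimpleGraph (Fin n), (if ¬ Close W F ε then indDensity F W else 0) < 1 / 3 := by
  set η := ε / 4 with hη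
  have hη0 : 0 < η := by positivity
  set δ := min η (η ^ 4 / 12) with hδ
  have hδ0 : 0 < δ := by positivity
  obtain ⟨K, hK, hreg⟩ := weak_reg δ hδ0
  have hK' : (0 : ℝ) < K := by exact_mod_cast hK
  set τ := ε / (8 * K) with hτ
  have hτ0 : 0 < τ := by positivity
  obtain ⟨n₁, hn₁⟩ := exists_nat_gt (12 * (6 / η ^ 4 + K / τ ^ 2))
  refine ⟨n₁ + 1, by omega, fun n hn W hW => ?_⟩
  have hn0 : 0 < n := by omega
  have hn' : (0 : ℝ) < n := by exact_mod_cast hn0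
  have hnn : 12 * (6 / η ^ 4 + K / τ ^ 2) < n := hn₁.trans (by exact_mod_cast (by omega : n₁ < n))
  obtain ⟨a, M, ha, hM, hr⟩ := hreg _ W graphon_one hW
  simp only [one_mul] at hr
  let C4 : SimpleGraph (Fin n) → (Fin n → ℝ) → ℝ := fun F x =>
    ∑ j, ∑ l, (∑ i, devB F a M x i j * devB F a M x i l) ^ 2
  let S : Fin K → (Fin n → ℝ) → ℝ := fun c x =>
    ∑ i, ((a ⁻¹' {c}).indicator (fun _ => (1 : ℝ)) (x i) - muI.real (a ⁻¹' {c}))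
  have hac : ∀ c, MeasurableSet (a ⁻¹' {c}) := fun c => ha (measurableSet_singleton c)
  have hC4m : ∀ F, Measurable (C4 F) := fun F =>
    Finset.measurable_fun_sum _ fun j _ => Finset.measurable_fun_sum _ fun l _ =>
      (Finset.measurable_fun_sum _ fun i _ =>
        (devB_meas F ha M i j).mul (devB_meas F ha M i l)).pow_const 2
  have hC40 : ∀ F x, 0 ≤ C4 F x := fun F x =>
    Finset.sum_nonneg fun _ _ => Finset.sum_nonneg fun _ _ => sq_nonneg _
  have hsq : ∀ (t : Fin n → ℝ), (∀ i, |t i| ≤ 1) → (∑ i, t i) ^ 2 ≤ (n : ℝ) ^ 2 := by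
    intro t ht
    rw [← sq_abs]
    refine pow_le_pow_left₀ (abs_nonneg _) ?_ 2
    refine (Finset.abs_sum_le_sum_abs _ _).trans ?_
    refine (Finset.sum_le_sum fun i _ => ht i).trans ?_
    simp
  have hC4b : ∀ F x, C4 F x ≤ (n : ℝ) ^ 4 := by
    intro F x
    calc C4 F x ≤ ∑ j : Fin n, ∑ l : Fin n, (n : ℝ) ^ 2 := by
          refine Finset.sum_le_sum fun j _ => Finset.sum_le_sum fun l _ => hsq _ fun i => ?_
          rw [abs_mul]
          exact mul_le_one₀ (devB_le F a hM x _ _) (abs_nonneg _) (devB_le F a hM x _ _)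
      _ = (n : ℝ) ^ 4 := by simp; ring
  have hSm : ∀ c, Measurable (S c) := fun c => Finset.measurable_fun_sum _ fun i _ =>
    ((measurable_const.indicator (hac c)).comp (measurable_pi_apply i)).sub measurable_const
  have hSb : ∀ c x, (S c x) ^ 2 ≤ (n : ℝ) ^ 2 := fun c x => hsq _ fun i =>
    abs_sub_unit (by by_cases h : x i ∈ a ⁻¹' {c}
                     · rw [Set.indicator_of_mem h]; simp
                     · rw [Set.indicator_of_notMem h]; simp)
      ⟨measureReal_nonneg, measureReal_le_one⟩
  let A : ℝ := (n : ℝ) ^ 4 * η ^ 4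
  let A' : ℝ := (n : ℝ) ^ 2 * τ ^ 2
  have hA : 0 < A := by positivity
  have hA' : 0 < A' := by positivity
  let Φ : SimpleGraph (Fin n) → (Fin n → ℝ) → ℝ := fun F x =>
    C4 F x / A + (∑ c, (S c x) ^ 2) / A'
  have hV0 : ∀ x, 0 ≤ ∑ c, (S c x) ^ 2 := fun x => Finset.sum_nonneg fun _ _ => sq_nonneg _
  have hVb : ∀ x, ∑ c, (S c x) ^ 2 ≤ K * (n : ℝ) ^ 2 := fun x =>
    (Finset.sum_le_sum fun c _ => hSb c x).trans (by simp)
  have hVm : Measurable (fun x => ∑ c, (S c x) ^ 2) :=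
    Finset.measurable_fun_sum _ fun c _ => (hSm c).pow_const 2
  have hΦ0 : ∀ F x, 0 ≤ Φ F x := fun F x =>
    add_nonneg (div_nonneg (hC40 F x) hA.le) (div_nonneg (hV0 x) hA'.le)
  have hΦm : ∀ F, Measurable (Φ F) := fun F => ((hC4m F).div_const _).add (hVm.div_const _)
  have hΦb : ∀ F x, |Φ F x| ≤ (n : ℝ) ^ 4 / A + K * (n : ℝ) ^ 2 / A' := by
    intro F x
    rw [abs_of_nonneg (hΦ0 F x)]
    exact add_le_add (div_le_div_of_nonneg_right (hC4b F x) hA.le)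
      (div_le_div_of_nonneg_right (hVb x) hA'.le)
  have hbad : ∀ F, ¬ Close W F ε → ∀ x, 1 ≤ Φ F x := by
    intro F hF x
    by_contra hlt
    push Not at hlt
    have h1 : 0 ≤ C4 F x / A := div_nonneg (hC40 F x) hA.le
    have h2 : 0 ≤ (∑ c, (S c x) ^ 2) / A' := div_nonneg (hV0 x) hA'.le
    have h3 : C4 F x / A ≤ 1 := by simp only [Φ] at hlt; linarith
    have h4 : (∑ c, (S c x) ^ 2) / A' ≤ 1 := by simp only [Φ] at hlt; linarith
    rw [div_le_one hA] at h3
    rw [div_le_one hA'] at h4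
    refine hF ((close_of_good hn0 hW ha hM hη0.le hr F x h3 (τ := τ) fun c => ?_).mono ?_)
    · have h5 : (S c x) ^ 2 ≤ (n * τ) ^ 2 := by
        have := Finset.single_le_sum (f := fun c => (S c x) ^ 2) (fun c _ => sq_nonneg _)
          (Finset.mem_univ c)
        rw [mul_pow]; exact this.trans h4
      exact abs_le_of_sq_le_sq h5 (by positivity)
    · have h6 : (K : ℝ) * τ = ε / 8 := by rw [hτ]; field_simp
      have h7 : δ ≤ η := min_le_left _ _
      rw [h6]; linarith
  have mk := markov_graph hW.uk (fun F => ¬ Close W F ε) Φ hΦm _ hΦb hΦ0 hbad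
  refine lt_of_le_of_lt (le_of_eq_of_le (Finset.sum_congr rfl fun F _ => ?_) mk) ?_
  · by_cases h : Close W F ε <;> simp [h]
  have e : ∀ x : Fin n → ℝ, ∑ F : SimpleGraph (Fin n), wgt F (fun i j => W (x i) (x j)) * Φ F x =
      (∑ F : SimpleGraph (Fin n), wgt F (fun i j => W (x i) (x j)) * C4 F x) / A
        + (∑ c, (S c x) ^ 2) / A' := by
    intro x
    simp only [Φ, mul_add, Finset.sum_add_distrib, ← Finset.sum_mul, wgt_sum_one, one_mul]
    congr 1
    rw [Finset.sum_div]
    exact Finset.sum_congr rfl fun F _ => (mul_div_assoc _ _ _).symm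
  simp only [e]
  have hi1 : Integrable (fun x : Fin n → ℝ => ∑ F : SimpleGraph (Fin n),
      wgt F (fun i j => W (x i) (x j)) * C4 F x) (muP (Fin n)) :=
    integrable_finsetSum _ fun F _ => int_bdd ((wgt_meas F hW.uk).mul (hC4m F)) ((n : ℝ) ^ 4)
      fun x => by
        rw [abs_mul, abs_of_nonneg (hC40 F x)]
        have := mul_le_mul (wgt_le F hW.uk x) (hC4b F x) (hC40 F x) zero_le_one
        simpa using this
  have hiS : ∀ c, Integrable (fun x : Fin n → ℝ => (S c x) ^ 2) (muP (Fin n)) := fun c =>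
    int_bdd ((hSm c).pow_const 2) ((n : ℝ) ^ 2) fun x => by
      rw [abs_of_nonneg (sq_nonneg _)]; exact hSb c x
  have hi2 : Integrable (fun x : Fin n → ℝ => ∑ c, (S c x) ^ 2) (muP (Fin n)) :=
    integrable_finsetSum _ fun c _ => hiS c
  rw [integral_add (hi1.div_const _) (hi2.div_const _), integral_div, integral_div,
    integral_finsetSum _ fun c _ => hiS c]
  have b1 : ∫ x, ∑ F : SimpleGraph (Fin n), wgt F (fun i j => W (x i) (x j)) * C4 F x ∂(muP (Fin n))
      ≤ (n : ℝ) ^ 4 * δ + 6 * (n : ℝ) ^ 3 := c4_exp hW ha hM hr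
  have b2 : ∑ c, ∫ x, (S c x) ^ 2 ∂(muP (Fin n)) ≤ K * n :=
    (Finset.sum_le_sum fun c _ => var_exp (hac c)).trans (by simp)
  have c1 := div_le_div_of_nonneg_right b1 hA.le
  have c2 := div_le_div_of_nonneg_right b2 hA'.le
  have e1 : ((n : ℝ) ^ 4 * δ + 6 * (n : ℝ) ^ 3) / A = δ / η ^ 4 + (6 / η ^ 4) / n := by
    simp only [A]; field_simp
  have e2 : (K * n : ℝ) / A' = (K / τ ^ 2) / n := by
    simp only [A']; field_simp
  have e3 : δ / η ^ 4 ≤ 1 / 12 := by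
    rw [div_le_iff₀ (by positivity)]
    have : δ ≤ η ^ 4 / 12 := min_le_right _ _
    linarith
  have e4 : (6 / η ^ 4) / n + (K / τ ^ 2) / n ≤ 1 / 12 := by
    rw [← add_div, div_le_iff₀ hn']; linarith
  rw [e1] at c1
  rw [e2] at c2
  linarith

lemma IsGraphon.compl {V : ℝ → ℝ → ℝ} (h : IsGraphon V) : IsGraphon (fun x y => 1 - V x y) :=
  ⟨measurable_const.sub h.1, fun x y => by simp only [h.2.1 x y], fun x y => by
    have := h.2.2 x y
    exact ⟨by linarith [this.2], by linarith [this.1]⟩⟩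

/-- `U` is obtained from `V` by deleting with density `1 - p` and adding with density `q`. -/
lemma edit_exists {V U : ℝ → ℝ → ℝ} (hV : IsGraphon V) (hU : IsGraphon U) :
    ∃ p q : ℝ → ℝ → ℝ, IsGraphon p ∧ IsGraphon q ∧
      (∀ x y, U x y = p x y * V x y + q x y * (1 - V x y)) ∧
      ∀ x y, |V x y - U x y| = (1 - p x y) * V x y + q x y * (1 - V x y) := by
  classical
  have hle : MeasurableSet {z : ℝ × ℝ | Function.uncurry U z ≤ Function.uncurry V z} :=
    measurableSet_le hU.1 hV.1
  refine ⟨fun x y => if U x y ≤ V x y then U x y / V x y else 1,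
    fun x y => if U x y ≤ V x y then 0 else (U x y - V x y) / (1 - V x y), ⟨?_, ?_, ?_⟩,
    ⟨?_, ?_, ?_⟩, ?_, ?_⟩
  · exact Measurable.ite hle (hU.1.div hV.1) measurable_const
  · intro x y; simp only [hU.2.1 x y, hV.2.1 x y]
  · intro x y
    have a := hU.2.2 x y
    have b := hV.2.2 x y
    dsimp only
    split_ifs with h
    · exact ⟨div_nonneg a.1 b.1, div_le_one_of_le₀ h b.1⟩
    · simp
  · exact Measurable.ite hle measurable_const ((hU.1.sub hV.1).div (measurable_const.sub hV.1))
  · intro x y; simp only [hU.2.1 x y, hV.2.1 x y]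
  · intro x y
    have a := hU.2.2 x y
    have b := hV.2.2 x y
    dsimp only
    split_ifs with h
    · simp
    · push Not at h
      exact ⟨div_nonneg (by linarith) (by linarith [b.2]),
        div_le_one_of_le₀ (by linarith [a.2]) (by linarith [b.2])⟩
  · intro x y
    have a := hU.2.2 x y
    have b := hV.2.2 x y
    dsimp only
    split_ifs with h
    · rcases eq_or_lt_of_le b.1 with h0 | h0
      · rw [← h0] at h ⊢; simp; linarith [a.1]
      · rw [div_mul_cancel₀ _ h0.ne']; ring
    · push Not at h
      have : 1 - V x y ≠ 0 := by have := a.2; intro h'; linarith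
      rw [div_mul_cancel₀ _ this]; ring
  · intro x y
    have a := hU.2.2 x y
    have b := hV.2.2 x y
    dsimp only
    split_ifs with h
    · rw [abs_of_nonneg (by linarith)]
      rcases eq_or_lt_of_le b.1 with h0 | h0
      · rw [← h0] at h ⊢; simp; linarith [a.1]
      · rw [sub_mul, div_mul_cancel₀ _ h0.ne']; ring
    · push Not at h
      have : 1 - V x y ≠ 0 := by have := a.2; intro h'; linarith
      rw [div_mul_cancel₀ _ this, abs_of_nonpos (by linarith)]; ring

/-- Regularised edits. -/
lemma edit_reg (δ : ℝ) (hδ : 0 < δ) : ∃ K : ℕ, 0 < K ∧ ∀ V U : ℝ → ℝ → ℝ, IsGraphon V →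
    IsGraphon U → ∃ (b : ℝ → Fin K × Fin K) (P Q : Fin K × Fin K → Fin K × Fin K → ℝ),
      Measurable b ∧ SM P ∧ SM Q ∧
      Reg (fun x y => U x y - (P (b x) (b y) * V x y + Q (b x) (b y) * (1 - V x y))) δ ∧
      ∫ z, ((1 - P (b z.1) (b z.2)) * V z.1 z.2 + Q (b z.1) (b z.2) * (1 - V z.1 z.2))
        ∂(muI.prod muI) ≤ l1Norm (fun x y => V x y - U x y) + δ := by
  obtain ⟨K, hK, hreg⟩ := weak_reg (δ / 2) (by positivity)
  refine ⟨K, hK, fun V U hV hU => ?_⟩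
  obtain ⟨p, q, hp, hq, h1, h2⟩ := edit_exists hV hU
  obtain ⟨b₁, M₁, hb₁, hM₁, hr₁⟩ := hreg V p hV hp
  obtain ⟨b₂, M₂, hb₂, hM₂, hr₂⟩ := hreg _ q hV.compl hq
  have B1 : BK (fun x y => V x y * (p x y - M₁ (b₁ x) (b₁ y))) :=
    (BK.graphon hV).mul ((BK.graphon hp).sub (BK.step hb₁ M₁))
  have B2 : BK (fun x y => (1 - V x y) * (q x y - M₂ (b₂ x) (b₂ y))) :=
    (BK.graphon hV.compl).mul ((BK.graphon hq).sub (BK.step hb₂ M₂))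
  refine ⟨fun x => (b₁ x, b₂ x), fun i j => M₁ i.1 j.1, fun i j => M₂ i.2 j.2,
    hb₁.prodMk hb₂, ⟨fun i j => hM₁.1 _ _, fun i j => hM₁.2 _ _⟩,
    ⟨fun i j => hM₂.1 _ _, fun i j => hM₂.2 _ _⟩, ?_, ?_⟩
  · have := Reg.add B1 B2 hr₁ hr₂
    rw [add_halves] at this
    convert this using 3 with x y
    rw [h1 x y]; ring
  · have a1 := hr₁ (fun _ => 1) (fun _ => 1) measurable_const measurable_const (by simp) (by simp)
    have a2 := hr₂ (fun _ => 1) (fun _ => 1) measurable_const measurable_const (by simp) (by simp)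
    simp only [mul_one] at a1 a2
    rw [l1Norm_eq ((BK.graphon hV).sub (BK.graphon hU))]
    have e : ∫ z : ℝ × ℝ, ((1 - M₁ (b₁ z.1) (b₁ z.2)) * V z.1 z.2
          + M₂ (b₂ z.1) (b₂ z.2) * (1 - V z.1 z.2)) ∂(muI.prod muI)
        = ∫ z : ℝ × ℝ, |V z.1 z.2 - U z.1 z.2| ∂(muI.prod muI)
          + ∫ z : ℝ × ℝ, V z.1 z.2 * (p z.1 z.2 - M₁ (b₁ z.1) (b₁ z.2)) ∂(muI.prod muI)
          - ∫ z : ℝ × ℝ, (1 - V z.1 z.2) * (q z.1 z.2 - M₂ (b₂ z.1) (b₂ z.2)) ∂(muI.prod muI) := by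
      rw [← integral_add ((BK.graphon hV).sub (BK.graphon hU)).abs.integrable B1.integrable,
        ← integral_sub _ B2.integrable]
      · congr 1; ext z
        rw [h2 z.1 z.2]; ring
      · exact ((BK.graphon hV).sub (BK.graphon hU)).abs.integrable.add B1.integrable
    refine e.le.trans ?_
    have := (abs_le.1 a1).2
    have := (abs_le.1 a2).1
    linarith

section
variable {κ : Type} [Fintype κ] [MeasurableSpace κ] [MeasurableSingletonClass κ]

/-- Edit a kernel by step functions. -/
def edit (b : ℝ → κ) (P Q : κ → κ → ℝ) (A : ℝ → ℝ → ℝ) : ℝ → ℝ → ℝ := fun x y =>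
  P (b x) (b y) * A x y + Q (b x) (b y) * (1 - A x y)

/-- The cost of an edit. -/
def ecost (b : ℝ → κ) (P Q : κ → κ → ℝ) (A : ℝ → ℝ → ℝ) : ℝ :=
  ∫ z : ℝ × ℝ, ((1 - P (b z.1) (b z.2)) * A z.1 z.2 + Q (b z.1) (b z.2) * (1 - A z.1 z.2))
    ∂(muI.prod muI)

lemma edit_graphon {b : ℝ → κ} (hb : Measurable b) {P Q : κ → κ → ℝ} (hP : SM P) (hQ : SM Q)
    {A : ℝ → ℝ → ℝ} (hA : IsGraphon A) : IsGraphon (edit b P Q A) := by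
  refine ⟨?_, fun x y => ?_, fun x y => ?_⟩
  · exact (((BK.step hb P).mul (BK.graphon hA)).add
      ((BK.step hb Q).mul (BK.graphon hA.compl))).1
  · simp only [edit, hA.2.1 x y, hP.1 (b x), hQ.1 (b x)]
  · have a := hA.2.2 x y
    have p := hP.2 (b x) (b y)
    have q := hQ.2 (b x) (b y)
    simp only [edit, Set.mem_Icc] at *
    constructor
    · have := mul_nonneg p.1 a.1
      have := mul_nonneg q.1 (sub_nonneg.2 a.2)
      linarith
    · have := mul_le_mul_of_nonneg_right p.2 a.1
      have := mul_le_mul_of_nonneg_right q.2 (sub_nonneg.2 a.2)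
      linarith

lemma edit_close {b : ℝ → κ} (hb : Measurable b) {P Q : κ → κ → ℝ} (hP : SM P) (hQ : SM Q)
    {A B : ℝ → ℝ → ℝ} (hA : IsGraphon A) (hB : IsGraphon B) {ε : ℝ}
    (h : Reg (fun x y => A x y - B x y) ε) :
    Reg (fun x y => edit b P Q A x y - edit b P Q B x y) ((Fintype.card κ : ℝ) ^ 2 * ε) := by
  have := Reg.step_mul hb (M := fun i j => P i j - Q i j)
    (fun i j => abs_sub_unit (hP.2 _ _) (hQ.2 _ _)) ((BK.graphon hA).sub (BK.graphon hB)) h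
  convert this using 3 with x y
  simp only [edit]; ring

lemma ecost_close {b : ℝ → κ} (hb : Measurable b) {P Q : κ → κ → ℝ} (hP : SM P) (hQ : SM Q)
    {A B : ℝ → ℝ → ℝ} (hA : IsGraphon A) (hB : IsGraphon B) {ε : ℝ}
    (h : Reg (fun x y => A x y - B x y) ε) :
    ecost b P Q A ≤ ecost b P Q B + (Fintype.card κ : ℝ) ^ 2 * ε := by
  have h1 := Reg.step_mul hb (M := fun i j => (1 - P i j) - Q i j)
    (fun i j => abs_sub_unit (by
      have := hP.2 i j
      exact ⟨by linarith [this.2], by linarith [this.1]⟩) (hQ.2 _ _))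
    ((BK.graphon hA).sub (BK.graphon hB)) h
  have h2 := h1 (fun _ => 1) (fun _ => 1) measurable_const measurable_const (by simp) (by simp)
  simp only [mul_one] at h2
  have e : ∀ {C : ℝ → ℝ → ℝ}, IsGraphon C → Integrable (fun z : ℝ × ℝ =>
      (1 - P (b z.1) (b z.2)) * C z.1 z.2 + Q (b z.1) (b z.2) * (1 - C z.1 z.2))
      (muI.prod muI) := fun hC => ((((BK.const 1).sub (BK.step hb P)).mul (BK.graphon hC)).add
        ((BK.step hb Q).mul (BK.graphon hC.compl))).integrable
  have e2 : ecost b P Q A - ecost b P Q B = ∫ z : ℝ × ℝ, (1 - P (b z.1) (b z.2)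
      - Q (b z.1) (b z.2)) * (A z.1 z.2 - B z.1 z.2) ∂(muI.prod muI) := by
    unfold ecost
    rw [← integral_sub (e hA) (e hB)]
    congr 1; ext z; ring
  rw [← e2] at h2
  linarith [(abs_le.1 h2).2]

lemma edit_l1 {b : ℝ → κ} (hb : Measurable b) {P Q : κ → κ → ℝ} (hP : SM P) (hQ : SM Q)
    {A : ℝ → ℝ → ℝ} (hA : IsGraphon A) :
    l1Norm (fun x y => A x y - edit b P Q A x y) ≤ ecost b P Q A := by
  have hE := edit_graphon hb hP hQ hA
  rw [l1Norm_eq ((BK.graphon hA).sub (BK.graphon hE))]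
  refine integral_mono ((BK.graphon hA).sub (BK.graphon hE)).abs.integrable
    ((((BK.const 1).sub (BK.step hb P)).mul (BK.graphon hA)).add
        ((BK.step hb Q).mul (BK.graphon hA.compl))).integrable fun z => ?_
  have a := hA.2.2 z.1 z.2
  have p := hP.2 (b z.1) (b z.2)
  have q := hQ.2 (b z.1) (b z.2)
  have t1 : 0 ≤ (1 - P (b z.1) (b z.2)) * A z.1 z.2 := mul_nonneg (by linarith [p.2]) a.1
  have t2 : 0 ≤ Q (b z.1) (b z.2) * (1 - A z.1 z.2) := mul_nonneg q.1 (by linarith [a.2])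
  simp only [edit]
  rw [abs_le]
  constructor <;> linarith
end

lemma adj_graphon {n : ℕ} (F : SimpleGraph (Fin n)) {s : ℝ → Fin n} (hs : Measurable s) :
    IsGraphon (fun x y => adjR F (s x) (s y)) :=
  ⟨(BK.step hs (adjR F)).1, fun _ _ => adjR_symm _ _ _, fun _ _ => adjR_mem _ _ _⟩

/-- If `W` and `V` are both close to `F`, an edit of `V` is transported to an edit of `W`. -/
lemma move_edit {n : ℕ} {F : SimpleGraph (Fin n)} {W V U : ℝ → ℝ → ℝ} (hW : IsGraphon W)
    (hV : IsGraphon V) (hU : IsGraphon U) {ε δ : ℝ} (cW : Close W F ε) (cV : Close V F ε)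
    {K : ℕ} (hK : 0 < K) {b : ℝ → Fin K × Fin K}
    {P Q : Fin K × Fin K → Fin K × Fin K → ℝ} (hb : Measurable b) (hP : SM P) (hQ : SM Q)
    (hr : Reg (fun x y => U x y - (P (b x) (b y) * V x y + Q (b x) (b y) * (1 - V x y))) δ)
    (hc : ∫ z, ((1 - P (b z.1) (b z.2)) * V z.1 z.2 + Q (b z.1) (b z.2) * (1 - V z.1 z.2))
        ∂(muI.prod muI) ≤ l1Norm (fun x y => V x y - U x y) + δ) :
    ∃ U', IsGraphon U' ∧
      l1Norm (fun x y => W x y - U' x y) ≤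
        l1Norm (fun x y => V x y - U x y) + δ + 2 * ((K : ℝ) ^ 4 * ε) ∧
      ∀ (m : ℕ) (H : SimpleGraph (Fin m)), |indDensity H U' - indDensity H U| ≤
        (m : ℝ) ^ 2 * (δ + 2 * ((K : ℝ) ^ 4 * ε)) := by
  obtain ⟨s, hs, hsu, hsr⟩ := cW
  obtain ⟨t, ht, htu, htr⟩ := cV
  have : Nonempty (Fin K × Fin K) := ⟨(⟨0, hK⟩, ⟨0, hK⟩)⟩
  obtain ⟨b', hb', hl⟩ := transfer hs ht (fun i => by rw [hsu, htu]) hb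
  have hcard : ((Fintype.card (Fin K × Fin K) : ℝ)) ^ 2 = (K : ℝ) ^ 4 := by
    simp; ring
  have gs := adj_graphon F hs
  have gt := adj_graphon F ht
  have gU' := edit_graphon hb' hP hQ hW
  refine ⟨edit b' P Q W, gU', ?_, fun m H => ?_⟩
  · have h1 := edit_l1 hb' hP hQ hW
    have h2 := ecost_close hb' hP hQ hW gs hsr
    have h3 := ecost_close hb hP hQ gt hV htr.swap
    have h4 : ecost b' P Q (fun x y => adjR F (s x) (s y))
        = ecost b P Q (fun x y => adjR F (t x) (t y)) :=
      law_int (hs.prodMk hb') (ht.prodMk hb) hl (fun i j =>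
        (1 - P i.2 j.2) * adjR F i.1 j.1 + Q i.2 j.2 * (1 - adjR F i.1 j.1))
    have h5 : ecost b P Q V ≤ _ := hc
    rw [hcard] at h2 h3
    linarith
  · have gE := edit_graphon hb hP hQ hV
    have h1 := edit_close hb' hP hQ hW gs hsr
    have h2 := edit_close hb hP hQ gt hV htr.swap
    have h3 : Reg (fun x y => edit b P Q V x y - U x y) δ := Reg.swap hr
    have h4 := counting H gU'.uk (edit_graphon hb' hP hQ gs).uk h1
    have h5 := counting H (edit_graphon hb hP hQ gt).uk gE.uk h2
    have h6 := counting H gE.uk hU.uk h3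
    have h7 : indDensity H (edit b' P Q (fun x y => adjR F (s x) (s y)))
        = indDensity H (edit b P Q (fun x y => adjR F (t x) (t y))) :=
      law_ind (hs.prodMk hb') (ht.prodMk hb) hl (fun i j =>
        P i.2 j.2 * adjR F i.1 j.1 + Q i.2 j.2 * (1 - adjR F i.1 j.1)) H
    rw [hcard] at h4 h5
    rw [h7] at h4
    rw [abs_le] at *
    constructor <;> nlinarith [h4.1, h4.2, h5.1, h5.2, h6.1, h6.2]

lemma l1_nonneg (W : ℝ → ℝ → ℝ) : 0 ≤ l1Norm W := by
  unfold l1Norm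
  exact integral_nonneg fun x => integral_nonneg fun y => abs_nonneg _

lemma d1_ne_top (W : ℝ → ℝ → ℝ) {R : Set (ℝ → ℝ → ℝ)} (hne : R.Nonempty) :
    d1SetE W R ≠ ⊤ := by
  obtain ⟨U, hU⟩ := hne
  exact ne_top_of_le_ne_top ENNReal.ofReal_ne_top (iInf₂_le U hU)

lemma d1_le (W : ℝ → ℝ → ℝ) {R : Set (ℝ → ℝ → ℝ)} {U : ℝ → ℝ → ℝ} (hU : U ∈ R) :
    (d1SetE W R).toReal ≤ l1Norm (fun x y => W x y - U x y) :=
  ENNReal.toReal_le_of_le_ofReal (l1_nonneg _) (iInf₂_le U hU)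

lemma d1_approx (W : ℝ → ℝ → ℝ) {R : Set (ℝ → ℝ → ℝ)} (hne : R.Nonempty) {ε : ℝ} (hε : 0 < ε) :
    ∃ U ∈ R, l1Norm (fun x y => W x y - U x y) ≤ (d1SetE W R).toReal + ε := by
  by_contra! h
  have h1 : ENNReal.ofReal ((d1SetE W R).toReal + ε) ≤ d1SetE W R :=
    le_iInf₂ fun U hU => ENNReal.ofReal_le_ofReal (h U hU).le
  have h2 := (ENNReal.ofReal_le_iff_le_toReal (d1_ne_top W hne)).1 h1
  linarith

lemma d1_tri {W U' : ℝ → ℝ → ℝ} (hW : IsGraphon W) (hU' : IsGraphon U') {R : Set (ℝ → ℝ → ℝ)}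
    (hR : ∀ W ∈ R, IsGraphon W) (hne : R.Nonempty) :
    (d1SetE W R).toReal ≤ l1Norm (fun x y => W x y - U' x y) + (d1SetE U' R).toReal := by
  refine le_of_forall_pos_le_add fun ε hε => ?_
  obtain ⟨U, hU, h⟩ := d1_approx U' hne hε
  refine (d1_le W hU).trans ?_
  have hUg := hR U hU
  have b1 := (BK.graphon hW).sub (BK.graphon hUg)
  have b2 := (BK.graphon hW).sub (BK.graphon hU')
  have b3 := (BK.graphon hU').sub (BK.graphon hUg)
  have : l1Norm (fun x y => W x y - U x y) ≤
      l1Norm (fun x y => W x y - U' x y) + l1Norm (fun x y => U' x y - U x y) := by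
    rw [l1Norm_eq b1, l1Norm_eq b2, l1Norm_eq b3,
      ← integral_add b2.abs.integrable b3.abs.integrable]
    exact integral_mono b1.abs.integrable (b2.abs.integrable.add b3.abs.integrable)
      fun z => abs_sub_le _ _ _
  linarith

lemma probIn_close {m : ℕ} {U U' : ℝ → ℝ → ℝ} {c : ℝ} (hc : 0 ≤ c)
    (h : ∀ H : SimpleGraph (Fin m), |indDensity H U' - indDensity H U| ≤ c) (R' : GraphProp) :
    probIn m U R' ≤ probIn m U' R' + (Nat.card (SimpleGraph (Fin m)) : ℝ) * c := by
  classical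
  unfold probIn
  have : (Nat.card (SimpleGraph (Fin m)) : ℝ) * c = ∑ _H : SimpleGraph (Fin m), c := by
    rw [Nat.card_eq_fintype_card]; simp
  rw [this, ← Finset.sum_add_distrib]
  refine Finset.sum_le_sum fun H _ => ?_
  have := (abs_le.1 (h H)).1
  split_ifs <;> linarith

/-- Two graphons close to the same graph have nearly the same distance from a testable property. -/
lemma core {R : Set (ℝ → ℝ → ℝ)} (hR : ∀ W ∈ R, IsGraphon W) (hne : R.Nonempty)
    (hT : GraphonTestable R) (ε : ℝ) (hε : 0 < ε) :
    ∃ e : ℝ, 0 < e ∧ ∀ (n : ℕ) (F : SimpleGraph (Fin n)) (W V : ℝ → ℝ → ℝ), IsGraphon W →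
      IsGraphon V → Close W F e → Close V F e →
      (d1SetE W R).toReal ≤ (d1SetE V R).toReal + ε := by
  obtain ⟨R', -, hA, hB⟩ := hT
  obtain ⟨m, hm1, hm⟩ := hB (ε / 4) (by positivity)
  set N : ℝ := (Nat.card (SimpleGraph (Fin m)) : ℝ) * (m : ℝ) ^ 2 with hN
  have hN0 : 0 ≤ N := by positivity
  set δ := min (ε / 4) (1 / (12 * (N + 1))) with hδ
  have hδ0 : 0 < δ := by positivity
  obtain ⟨K, hK, hreg⟩ := edit_reg δ hδ0
  have hK' : (0 : ℝ) < K := by exact_mod_cast hK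
  refine ⟨δ / (2 * (K : ℝ) ^ 4), by positivity, fun n F W V hW hV cW cV => ?_⟩
  obtain ⟨U, hU, hUd⟩ := d1_approx V hne (ε := ε / 4) (by positivity)
  obtain ⟨b, P, Q, hb, hP, hQ, hr, hc⟩ := hreg V U hV (hR U hU)
  obtain ⟨U', hU', hl, hi⟩ := move_edit hW hV (hR U hU) cW cV hK hb hP hQ hr hc
  have e1 : 2 * ((K : ℝ) ^ 4 * (δ / (2 * (K : ℝ) ^ 4))) = δ := by field_simp
  rw [e1] at hl hi
  have h1 := probIn_close (by positivity) (hi m) R'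
  have h2 := hA U hU m hm1
  have h3 : N * (δ + δ) ≤ 1 / 6 := by
    have : δ ≤ 1 / (12 * (N + 1)) := min_le_right _ _
    rw [le_div_iff₀ (by positivity)] at this
    nlinarith
  have h4 : 1 / 3 < probIn m U' R' := by
    rw [← mul_assoc, ← hN] at h1
    linarith
  have h5 : (d1SetE U' R).toReal < ε / 4 := by
    by_contra! h
    have := hm m le_rfl U' hU' ((ENNReal.ofReal_le_iff_le_toReal (d1_ne_top U' hne)).2 h)
    linarith
  have h6 := d1_tri hW hU' hR hne
  have h7 : δ ≤ ε / 4 := min_le_left _ _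
  linarith

lemma diag (N : ℕ → ℕ) : ∃ j : ℕ → ℕ, (∀ J, ∃ k₀, ∀ k, k₀ ≤ k → J ≤ j k) ∧
    ∀ k, N 0 ≤ k → N (j k) ≤ k := by
  classical
  refine ⟨fun k => Nat.findGreatest (fun j => N j ≤ k) k, fun J => ⟨max J (N J), fun k hk => ?_⟩,
    fun k hk => ?_⟩
  · exact Nat.le_findGreatest ((le_max_left _ _).trans hk) ((le_max_right _ _).trans hk)
  · exact Nat.findGreatest_spec (P := fun j => N j ≤ k) (Nat.zero_le _) hk

lemma prob_mono {n : ℕ} {W : ℝ → ℝ → ℝ} (hW : UK W) (p q : SimpleGraph (Fin n) → Prop)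
    {_ : DecidablePred p} {_ : DecidablePred q} (h : ∀ F, p F → q F) :
    ∑ F, (if p F then indDensity F W else 0) ≤ ∑ F, (if q F then indDensity F W else 0) := by
  refine Finset.sum_le_sum fun F _ => ?_
  have := ind_nonneg F hW
  by_cases h1 : p F
  · simp [h1, h F h1]
  · rw [if_neg h1]; split_ifs <;> simp [this]

lemma inv_mono {J j : ℕ} (h : J ≤ j) : 1 / ((j : ℝ) + 1) ≤ 1 / ((J : ℝ) + 1) := by
  have : (J : ℝ) ≤ j := by exact_mod_cast h
  exact one_div_le_one_div_of_le (by positivity) (by linarith)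

theorem forward {R : Set (ℝ → ℝ → ℝ)} (hR : ∀ W ∈ R, IsGraphon W) (hne : R.Nonempty)
    (hT : GraphonTestable R) : TestableFunctional (fun W => (d1SetE W R).toReal) := by
  classical
  have hcore := fun j : ℕ => core hR hne hT (1 / ((j : ℝ) + 1)) (by positivity)
  choose e he0 he using hcore
  choose N hN1 hN using fun j => sampling (e j) (he0 j)
  obtain ⟨j, hj1, hj2⟩ := diag N
  let V : ∀ n, SimpleGraph (Fin n) → ℝ → ℝ → ℝ := fun n F =>
    Classical.epsilon fun V => IsGraphon V ∧ Close V F (e (j n))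
  refine ⟨fun n F => (d1SetE (V n F) R).toReal, fun n G H ⟨φ⟩ => ?_, fun ε hε => ?_⟩
  · have : V n G = V n H := by
      simp only [V]
      congr 1
      funext V
      exact propext ⟨fun h => ⟨h.1, h.2.iso φ⟩, fun h => ⟨h.1, h.2.iso φ.symm⟩⟩
    simp only [this]
  · obtain ⟨J, hJ⟩ := exists_nat_one_div_lt hε
    obtain ⟨k₀, hk₀⟩ := hj1 J
    refine ⟨max (max k₀ (N 0)) 1, le_max_right _ _, fun k hk W hW => ?_⟩
    have hk1 : k₀ ≤ k := ((le_max_left _ _).trans (le_max_left _ _)).trans hk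
    have hk2 : N 0 ≤ k := ((le_max_right _ _).trans (le_max_left _ _)).trans hk
    refine lt_of_le_of_lt ?_ (hN (j k) k (hj2 k hk2) W hW)
    refine prob_mono hW.uk _ _ fun F hF hC => ?_
    have hs : IsGraphon (V k F) ∧ Close (V k F) F (e (j k)) :=
      Classical.epsilon_spec (p := fun V => IsGraphon V ∧ Close V F (e (j k))) ⟨W, hW, hC⟩
    have a := he (j k) k F W _ hW hs.1 hC hs.2
    have b := he (j k) k F _ W hs.1 hW hs.2 hC
    have c := inv_mono (hk₀ k hk1)
    have : |(d1SetE W R).toReal - (d1SetE (V k F) R).toReal| ≤ 1 / ((j k : ℝ) + 1) := by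
      rw [abs_le]; constructor <;> linarith
    linarith

theorem backward {R : Set (ℝ → ℝ → ℝ)} (hR : ∀ W ∈ R, IsGraphon W) (hne : R.Nonempty)
    (hT : TestableFunctional (fun W => (d1SetE W R).toReal)) : GraphonTestable R := by
  classical
  obtain ⟨g, hg, hT⟩ := hT
  choose N hN1 hN using fun j : ℕ => hT (1 / ((j : ℝ) + 1)) (by positivity)
  obtain ⟨j, hj1, hj2⟩ := diag N
  refine ⟨fun n => {F | N 0 ≤ n → |g n F| ≤ 1 / ((j n : ℝ) + 1)}, fun n G H h => ?_,
    fun W hWR k hk1 => ?_, fun ε hε => ?_⟩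
  · simp only [Set.mem_ofPred_eq, hg n G H h]
  · have hW := hR W hWR
    have h0 : (d1SetE W R).toReal = 0 := by
      refine le_antisymm ((d1_le W hWR).trans ?_) ENNReal.toReal_nonneg
      simp [l1Norm]
    have hs := ind_sum (n := k) hW.uk
    unfold probIn
    by_cases hk : N 0 ≤ k
    · have h1 := hN (j k) k (hj2 k hk) W hW
      simp only [h0, zero_sub, abs_neg] at h1
      have h2 : ∑ F : SimpleGraph (Fin k), indDensity F W =
          ∑ F : SimpleGraph (Fin k), (if |g k F| ≤ 1 / ((j k : ℝ) + 1) then indDensity F W else 0)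
          + ∑ F : SimpleGraph (Fin k),
            (if 1 / ((j k : ℝ) + 1) < |g k F| then indDensity F W else 0) := by
        rw [← Finset.sum_add_distrib]
        refine Finset.sum_congr rfl fun F _ => ?_
        by_cases h : |g k F| ≤ 1 / ((j k : ℝ) + 1)
        · rw [if_pos h, if_neg (not_lt.2 h), add_zero]
        · rw [if_neg h, if_pos (not_le.1 h), zero_add]
      have h3 : ∑ F : SimpleGraph (Fin k),
          (if |g k F| ≤ 1 / ((j k : ℝ) + 1) then indDensity F W else 0) ≤
          ∑ F : SimpleGraph (Fin k), (if F ∈ {F | N 0 ≤ k → |g k F| ≤ 1 / ((j k : ℝ) + 1)} then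
            indDensity F W else 0) := prob_mono hW.uk _ _ fun F hF _ => hF
      refine le_trans ?_ (h3.trans (le_of_eq ?_))
      · rw [h2] at hs
        have h4 : ∑ F : SimpleGraph (Fin k),
            (if 1 / ((j k : ℝ) + 1) < |g k F| then indDensity F W else 0) < 1 / 3 := by
          convert h1
        linarith
      · exact Finset.sum_congr rfl fun F _ => by congr
    · have : ∑ F : SimpleGraph (Fin k), (if F ∈ {F | N 0 ≤ k → |g k F| ≤ 1 / ((j k : ℝ) + 1)} then
            indDensity F W else 0) = 1 := by
        rw [← hs]
        exact Finset.sum_congr rfl fun F _ => if_pos fun h => absurd h hk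
      refine le_trans (by norm_num) (this.symm.le.trans (le_of_eq ?_))
      exact Finset.sum_congr rfl fun F _ => by congr
  · obtain ⟨J, hJ⟩ := exists_nat_one_div_lt (half_pos hε)
    obtain ⟨k₀, hk₀⟩ := hj1 J
    refine ⟨max (max k₀ (N 0)) 1, le_max_right _ _, fun k hk W hW hd => ?_⟩
    have hk1 : k₀ ≤ k := ((le_max_left _ _).trans (le_max_left _ _)).trans hk
    have hk2 : N 0 ≤ k := ((le_max_right _ _).trans (le_max_left _ _)).trans hk
    have hf := (ENNReal.ofReal_le_iff_le_toReal (d1_ne_top W hne)).1 hd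
    have c := inv_mono (hk₀ k hk1)
    refine le_trans ?_ (hN (j k) k (hj2 k hk2) W hW).le
    unfold probIn
    refine prob_mono hW.uk _ _ fun F hF => ?_
    have h1 : |g k F| ≤ 1 / ((j k : ℝ) + 1) := hF hk2
    have h2 := le_abs_self ((d1SetE W R).toReal - g k F)
    have h3 := le_abs_self (g k F)
    linarith

theorem graphon_testable_iff_dist_testable_functional
    (R : Set (ℝ → ℝ → ℝ)) (hR : IsGraphonProperty R) (hne : R.Nonempty) :
    GraphonTestable R ↔ TestableFunctional (fun W => (d1SetE W R).toReal) := by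
  exact ⟨forward hR.1 hne, backward hR.1 hne⟩

end
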